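/- Let H be a finite dimensional quasitriangular Hopf π-coalgebra over a field k, let g = (g_α)_{α∈π} be the distinguished π-grouplike element of H, let ν be the distinguished grouplike element of H_1*, let u_α be the Drinfeld elements, let ℓ_α = S_{α⁻¹}(u_{α⁻¹})⁻¹ u_α, and let φ̂ : π → k \ {0} be the unique group homomorphism with λ_{βαβ⁻¹} ∘ φ_β = φ̂(β)λ_α for every right π-integral λ and all α, β ∈ π. For α ∈ π set h_α = (id_{H_α} ⊗ ν)(R_{α,1}) ∈ H_α. Then: (a) h = (h_α)_{α∈π} is a π-grouplike element of H; (b) g_α = φ̂(α)⁻¹ ℓ_α h_α for all α ∈ π. -/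

import Mathlib

open scoped TensorProduct

noncomputable section

/-- Transport of the algebra structure along an equality of group indices. -/
def gcast (k : Type*) [CommSemiring k] {π : Type*} (H : π → Type*)
    [∀ α, Ring (H α)] [∀ α, Algebra k (H α)] {a b : π} (h : a = b) :
    H a ≃ₐ[k] H b := by subst h; exact AlgEquiv.refl

/-- Transport of a module family along an equality of group indices. -/
def fcast (k : Type*) [CommSemiring k] {π : Type*} (M : π → Type*)
    [∀ α, AddCommGroup (M α)] [∀ α, Module k (M α)] {a b : π} (h : a = b) :
    M a ≃ₗ[k] M b := by subst h; exact LinearEquiv.refl k (M a)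

/-- A Hopf `π`-coalgebra (in the sense of Turaev/Virelizier) over a field `k`:
a family of `k`-algebras `H α` with comultiplication `Δ`, counit `ε` and antipode `S`. -/
class HopfGCoalgebra (k : Type*) [Field k] {π : Type*} [Group π]
    (H : π → Type*) [∀ α, Ring (H α)] [∀ α, Algebra k (H α)] where
  Δ : ∀ α β : π, H (α * β) →ₐ[k] H α ⊗[k] H β
  ε : H (1 : π) →ₐ[k] k
  S : ∀ α : π, H α →ₗ[k] H α⁻¹
  coassoc : ∀ α β γ : π,
    (TensorProduct.assoc k (H α) (H β) (H γ)).toLinearMap ∘ₗ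
        (TensorProduct.map (Δ α β).toLinearMap (LinearMap.id : H γ →ₗ[k] H γ)) ∘ₗ
        (Δ (α * β) γ).toLinearMap
      = (TensorProduct.map (LinearMap.id : H α →ₗ[k] H α) (Δ β γ).toLinearMap) ∘ₗ
        (Δ α (β * γ)).toLinearMap ∘ₗ (gcast k H (mul_assoc α β γ)).toLinearMap
  counit_right : ∀ α : π,
    (TensorProduct.rid k (H α)).toLinearMap ∘ₗ
        (TensorProduct.map (LinearMap.id : H α →ₗ[k] H α) ε.toLinearMap) ∘ₗ
        (Δ α 1).toLinearMap ∘ₗ (gcast k H (mul_one α).symm).toLinearMap = LinearMap.id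
  counit_left : ∀ α : π,
    (TensorProduct.lid k (H α)).toLinearMap ∘ₗ
        (TensorProduct.map ε.toLinearMap (LinearMap.id : H α →ₗ[k] H α)) ∘ₗ
        (Δ 1 α).toLinearMap ∘ₗ (gcast k H (one_mul α).symm).toLinearMap = LinearMap.id
  antipode_left : ∀ α : π,
    (LinearMap.mul' k (H α)) ∘ₗ
        (TensorProduct.map ((gcast k H (inv_inv α)).toLinearMap ∘ₗ S α⁻¹)
          (LinearMap.id : H α →ₗ[k] H α)) ∘ₗ (Δ α⁻¹ α).toLinearMap
      = (Algebra.linearMap k (H α)) ∘ₗ ε.toLinearMap ∘ₗ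
        (gcast k H (inv_mul_cancel α)).toLinearMap
  antipode_right : ∀ α : π,
    (LinearMap.mul' k (H α)) ∘ₗ
        (TensorProduct.map (LinearMap.id : H α →ₗ[k] H α)
          ((gcast k H (inv_inv α)).toLinearMap ∘ₗ S α⁻¹)) ∘ₗ (Δ α α⁻¹).toLinearMap
      = (Algebra.linearMap k (H α)) ∘ₗ ε.toLinearMap ∘ₗ
        (gcast k H (mul_inv_cancel α)).toLinearMap

namespace HopfGCoalgebra

variable (k : Type*) [Field k] {π : Type*} [Group π] (H : π → Type*)
  [∀ α, Ring (H α)] [∀ α, Algebra k (H α)] [HopfGCoalgebra k H]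

/-- A left `π`-integral for `H`. -/
def IsLeftIntegral (lam : ∀ α : π, H α →ₗ[k] k) : Prop :=
  ∀ (α β : π) (x : H (α * β)),
    (TensorProduct.rid k (H α))
        (TensorProduct.map (LinearMap.id : H α →ₗ[k] H α) (lam β) (Δ α β x))
      = lam (α * β) x • (1 : H α)

/-- A right `π`-integral for `H`. -/
def IsRightIntegral (lam : ∀ α : π, H α →ₗ[k] k) : Prop :=
  ∀ (α β : π) (x : H (α * β)),
    (TensorProduct.lid k (H β))
        (TensorProduct.map (lam α) (LinearMap.id : H β →ₗ[k] H β) (Δ α β x))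
      = lam (α * β) x • (1 : H β)

/-- A `π`-grouplike element of `H`. -/
def IsGrouplike (g : ∀ α : π, H α) : Prop :=
  (∀ α β : π, Δ α β (g (α * β)) = g α ⊗ₜ[k] g β) ∧ ε (k := k) (H := H) (g 1) = 1

/-- `g` is the distinguished `π`-grouplike element of `H`. -/
def IsDistinguishedGrouplike (g : ∀ α : π, H α) : Prop :=
  IsGrouplike k H g ∧
    ∀ lam : ∀ α : π, H α →ₗ[k] k, IsRightIntegral k H lam →
      ∀ (α β : π) (x : H (α * β)),
        (TensorProduct.rid k (H α))
            (TensorProduct.map (LinearMap.id : H α →ₗ[k] H α) (lam β) (Δ α β x))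
          = lam (α * β) x • g α

/-- `ν` is the distinguished grouplike element of `H₁*`. -/
def IsDistinguishedNu (ν : H (1 : π) →ₐ[k] k) : Prop :=
  ∀ Λ : H (1 : π), (∀ x : H (1 : π), x * Λ = ε (k := k) (H := H) x • Λ) →
    ∀ x : H (1 : π), Λ * x = ν x • Λ

/-- The right action `a ↼ f` of `f ∈ H₁*` on `a ∈ H α`. -/
def hitR (f : H (1 : π) →ₗ[k] k) {α : π} (a : H α) : H α :=
  (TensorProduct.lid k (H α))
    (TensorProduct.map f (LinearMap.id : H α →ₗ[k] H α)
      (Δ 1 α ((gcast k H (one_mul α).symm) a)))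

/-- The left action `f ⇀ a` of `f ∈ H₁*` on `a ∈ H α`. -/
def hitL (f : H (1 : π) →ₗ[k] k) {α : π} (a : H α) : H α :=
  (TensorProduct.rid k (H α))
    (TensorProduct.map (LinearMap.id : H α →ₗ[k] H α) f
      (Δ α 1 ((gcast k H (mul_one α).symm) a)))


/-- The comultiplication, with all arguments explicit. -/
def comul (α β : π) : H (α * β) →ₐ[k] H α ⊗[k] H β := Δ α β

/-- The counit, with all arguments explicit. -/
def counit : H (1 : π) →ₐ[k] k := ε

/-- The antipode, with all arguments explicit. -/
def antipode (α : π) : H α →ₗ[k] H α⁻¹ := S α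

end HopfGCoalgebra

open HopfGCoalgebra
/-- A right Hopf `π`-comodule over `H`. -/
class HopfGComodule (k : Type*) [Field k] {π : Type*} [Group π]
    (H : π → Type*) [∀ α, Ring (H α)] [∀ α, Algebra k (H α)] [HopfGCoalgebra k H]
    (M : π → Type*) [∀ α, AddCommGroup (M α)] [∀ α, Module k (M α)] where
  ρ : ∀ α β : π, M (α * β) →ₗ[k] M α ⊗[k] H β
  ρ_coassoc : ∀ α β γ : π,
    (TensorProduct.assoc k (M α) (H β) (H γ)).toLinearMap ∘ₗ
        (TensorProduct.map (ρ α β) (LinearMap.id : H γ →ₗ[k] H γ)) ∘ₗ (ρ (α * β) γ)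
      = (TensorProduct.map (LinearMap.id : M α →ₗ[k] M α) (Δ β γ).toLinearMap) ∘ₗ
        (ρ α (β * γ)) ∘ₗ (fcast k M (mul_assoc α β γ)).toLinearMap
  ρ_counit : ∀ α : π,
    (TensorProduct.rid k (M α)).toLinearMap ∘ₗ
        (TensorProduct.map (LinearMap.id : M α →ₗ[k] M α)
          (ε (k := k) (H := H)).toLinearMap) ∘ₗ
        (ρ α 1) ∘ₗ (fcast k M (mul_one α).symm).toLinearMap = LinearMap.id
  act : ∀ α : π, M α →ₗ[k] H α →ₗ[k] M α
  act_one : ∀ (α : π) (m : M α), act α m 1 = m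
  act_mul : ∀ (α : π) (m : M α) (a b : H α), act α (act α m a) b = act α m (a * b)
  ρ_act : ∀ (α β : π) (m : M (α * β)) (a : H (α * β)),
    ρ α β (act (α * β) m a)
      = TensorProduct.map (TensorProduct.lift (act α)) (LinearMap.mul' k (H β))
          ((TensorProduct.tensorTensorTensorComm k (M α) (H β) (H α) (H β))
            (ρ α β m ⊗ₜ[k] (Δ α β a)))

namespace HopfGComodule

variable (k : Type*) [Field k] {π : Type*} [Group π] (H : π → Type*)
  [∀ α, Ring (H α)] [∀ α, Algebra k (H α)] [HopfGCoalgebra k H]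
  (M : π → Type*) [∀ α, AddCommGroup (M α)] [∀ α, Module k (M α)] [HopfGComodule k H M]

/-- The submodule of coinvariant families of `H` on `M`. -/
def coinvFam : Submodule k (∀ α, M α) where
  carrier := {m | ∀ α β : π, ρ (H := H) α β (m (α * β)) = m α ⊗ₜ[k] (1 : H β)}
  add_mem' := by
    intro a b ha hb α β
    simp only [Pi.add_apply, map_add, ha α β, hb α β, TensorProduct.add_tmul]
  zero_mem' := by
    intro α β
    simp only [Pi.zero_apply, map_zero, TensorProduct.zero_tmul]
  smul_mem' := by
    intro c a ha α β
    simp only [Pi.smul_apply, map_smul, ha α β, TensorProduct.smul_tmul']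

/-- The `α`-component of the `π`-subcomodule of coinvariants. -/
def coinvSub (α : π) : Submodule k (M α) :=
  (coinvFam k H M).map (LinearMap.proj α : (∀ γ, M γ) →ₗ[k] M α)


/-- The comodule structure maps, with all arguments explicit. -/
def coact (α β : π) : M (α * β) →ₗ[k] M α ⊗[k] H β := ρ α β

/-- The right `H α`-action on `M α`, with all arguments explicit. -/
def hact (α : π) : M α →ₗ[k] H α →ₗ[k] M α := act α

end HopfGComodule

section Cosemisimple

variable (k : Type*) [Field k] {π : Type*} [Group π] (H : π → Type*)
  [∀ α, Ring (H α)] [∀ α, Algebra k (H α)]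
  (M : π → Type*) [∀ α, AddCommGroup (M α)] [∀ α, Module k (M α)]

/-- `N` is a `π`-subcomodule of the right `π`-comodule `(M, ρ)` over `H`. -/
def IsGSubcomodule (ρ : ∀ α β : π, M (α * β) →ₗ[k] M α ⊗[k] H β)
    (N : ∀ α, Submodule k (M α)) : Prop :=
  ∀ (α β : π), ∀ x ∈ N (α * β),
    ρ α β x ∈ LinearMap.range
      (TensorProduct.map (N α).subtype (LinearMap.id : H β →ₗ[k] H β))

/-- `N` is a simple `π`-subcomodule of `(M, ρ)`. -/
def IsSimpleGSubcomodule (ρ : ∀ α β : π, M (α * β) →ₗ[k] M α ⊗[k] H β)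
    (N : ∀ α, Submodule k (M α)) : Prop :=
  IsGSubcomodule k H M ρ N ∧ (∃ α, N α ≠ ⊥) ∧
    ∀ P : ∀ α, Submodule k (M α), IsGSubcomodule k H M ρ P → (∀ α, P α ≤ N α) →
      (∀ α, P α = ⊥) ∨ P = N

/-- The right `π`-comodule `(M, ρ)` is cosemisimple: it is the sum of its simple
`π`-subcomodules. -/
def IsGCosemisimple (ρ : ∀ α β : π, M (α * β) →ₗ[k] M α ⊗[k] H β) : Prop :=
  ∀ α : π,
    (⨆ N : {N : ∀ γ, Submodule k (M γ) // IsSimpleGSubcomodule k H M ρ N}, N.1 α) = ⊤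

end Cosemisimple

section CoalgCosemisimple

variable (k : Type*) [Field k] (C : Type*) [AddCommGroup C] [Module k C]

/-- `N` is a subcomodule of the coalgebra `(C, δ)` viewed as a right comodule over itself. -/
def IsSubcoideal (δ : C →ₗ[k] C ⊗[k] C) (N : Submodule k C) : Prop :=
  ∀ x ∈ N, δ x ∈ LinearMap.range (TensorProduct.map N.subtype (LinearMap.id : C →ₗ[k] C))

def IsSimpleSubcoideal (δ : C →ₗ[k] C ⊗[k] C) (N : Submodule k C) : Prop :=
  IsSubcoideal k C δ N ∧ N ≠ ⊥ ∧
    ∀ P : Submodule k C, IsSubcoideal k C δ P → P ≤ N → P = ⊥ ∨ P = N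

/-- The coalgebra `(C, δ)` is cosemisimple. -/
def IsCosemisimpleCoalgebra (δ : C →ₗ[k] C ⊗[k] C) : Prop :=
  (⨆ N : {N : Submodule k C // IsSimpleSubcoideal k C δ N}, N.1) = ⊤

end CoalgCosemisimple
/-- A crossed Hopf `π`-coalgebra: a Hopf `π`-coalgebra with a crossing `φ`. -/
class CrossedHopfGCoalgebra (k : Type*) [Field k] {π : Type*} [Group π]
    (H : π → Type*) [∀ α, Ring (H α)] [∀ α, Algebra k (H α)]
    extends HopfGCoalgebra k H where
  φ : ∀ β α : π, H α ≃ₐ[k] H (β * α * β⁻¹)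
  φ_comul : ∀ β α γ : π,
    (TensorProduct.map (φ β α).toLinearMap (φ β γ).toLinearMap) ∘ₗ (Δ α γ).toLinearMap
      = (Δ (β * α * β⁻¹) (β * γ * β⁻¹)).toLinearMap ∘ₗ
        (gcast k H (show β * (α * γ) * β⁻¹ = (β * α * β⁻¹) * (β * γ * β⁻¹) by
          group)).toLinearMap ∘ₗ (φ β (α * γ)).toLinearMap
  φ_counit : ∀ (β : π) (x : H (1 : π)),
    ε ((gcast k H (show β * 1 * β⁻¹ = (1 : π) by group)) (φ β 1 x)) = ε x
  φ_mul : ∀ (β β' α : π) (x : H α),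
    (gcast k H (show β * (β' * α * β'⁻¹) * β⁻¹ = (β * β') * α * (β * β')⁻¹ by group))
        (φ β (β' * α * β'⁻¹) (φ β' α x))
      = φ (β * β') α x


namespace CrossedHopfGCoalgebra

variable (k : Type*) [Field k] {π : Type*} [Group π] (H : π → Type*)
  [∀ α, Ring (H α)] [∀ α, Algebra k (H α)] [CrossedHopfGCoalgebra k H]

/-- The crossing, with all arguments explicit. -/
def crossing (β α : π) : H α ≃ₐ[k] H (β * α * β⁻¹) := φ β α

end CrossedHopfGCoalgebra

open CrossedHopfGCoalgebra

/-- A quasitriangular Hopf `π`-coalgebra: a crossed Hopf `π`-coalgebra with an R-matrix. -/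
class QTHopfGCoalgebra (k : Type*) [Field k] {π : Type*} [Group π]
    (H : π → Type*) [∀ α, Ring (H α)] [∀ α, Algebra k (H α)]
    extends CrossedHopfGCoalgebra k H where
  Rm : ∀ α β : π, H α ⊗[k] H β
  Rm_isUnit : ∀ α β : π, IsUnit (Rm α β)
  Rm_comul : ∀ (α β : π) (x : H (α * β)),
    Rm α β * Δ α β x
      = (TensorProduct.comm k (H β) (H α))
          ((TensorProduct.map
              ((gcast k H (show α⁻¹ * (α * β * α⁻¹) * α⁻¹⁻¹ = β by group)).toLinearMap ∘ₗ
                (φ α⁻¹ (α * β * α⁻¹)).toLinearMap)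
              (LinearMap.id : H α →ₗ[k] H α))
            ((Δ (α * β * α⁻¹) α)
              ((gcast k H (show α * β = (α * β * α⁻¹) * α by group)) x))) * Rm α β
  Rm_delta_right : ∀ α β γ : π,
    TensorProduct.map (LinearMap.id : H α →ₗ[k] H α) (Δ β γ).toLinearMap (Rm α (β * γ))
      = (TensorProduct.map (LinearMap.id : H α →ₗ[k] H α)
            (TensorProduct.mk k (H β) (H γ) 1) (Rm α γ))
        * (TensorProduct.map (LinearMap.id : H α →ₗ[k] H α)
            ((TensorProduct.mk k (H β) (H γ)).flip 1) (Rm α β))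
  Rm_delta_left : ∀ α β γ : π,
    (TensorProduct.assoc k (H α) (H β) (H γ))
        (TensorProduct.map (Δ α β).toLinearMap (LinearMap.id : H γ →ₗ[k] H γ)
          (Rm (α * β) γ))
      = (TensorProduct.map (LinearMap.id : H α →ₗ[k] H α)
            (TensorProduct.mk k (H β) (H γ) 1)
            (TensorProduct.map (LinearMap.id : H α →ₗ[k] H α)
              ((gcast k H (show β⁻¹ * (β * γ * β⁻¹) * β⁻¹⁻¹ = γ by group)).toLinearMap ∘ₗ
                (φ β⁻¹ (β * γ * β⁻¹)).toLinearMap)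
              (Rm α (β * γ * β⁻¹))))
        * (TensorProduct.mk k (H α) (H β ⊗[k] H γ) 1 (Rm β γ))
  Rm_phi : ∀ β α γ : π,
    TensorProduct.map (φ β α).toLinearMap (φ β γ).toLinearMap (Rm α γ)
      = Rm (β * α * β⁻¹) (β * γ * β⁻¹)

namespace QTHopfGCoalgebra

variable (k : Type*) [Field k] {π : Type*} [Group π] (H : π → Type*)
  [∀ α, Ring (H α)] [∀ α, Algebra k (H α)] [QTHopfGCoalgebra k H]

/-- The square of the antipode `S_{α⁻¹} ∘ S_α : H α → H α`. -/
def antipodeSq (α : π) : H α →ₗ[k] H α :=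
  (gcast k H (inv_inv α)).toLinearMap ∘ₗ S α⁻¹ ∘ₗ S α

/-- The map `S_{α⁻¹} ∘ φ_α : H (α⁻¹) → H α`. -/
def sphi (α : π) : H α⁻¹ →ₗ[k] H α :=
  (gcast k H (inv_inv α)).toLinearMap ∘ₗ S α⁻¹ ∘ₗ
    (gcast k H (show α * α⁻¹ * α⁻¹ = α⁻¹ by group)).toLinearMap ∘ₗ
    (φ α α⁻¹).toLinearMap

/-- The Drinfeld element `u_α = m_α ∘ (S_{α⁻¹}φ_α ⊗ id) ∘ σ_{α,α⁻¹} (R_{α,α⁻¹})`. -/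
def drinfeld (α : π) : H α :=
  LinearMap.mul' k (H α)
    (TensorProduct.map (sphi k H α) (LinearMap.id : H α →ₗ[k] H α)
      ((TensorProduct.comm k (H α) (H α⁻¹)) (Rm α α⁻¹)))

/-- The element `S_{α⁻¹}(u_{α⁻¹}) ∈ H α`. -/
def sdrinfeld (α : π) : H α :=
  (gcast k H (inv_inv α)) (S (k := k) (H := H) α⁻¹ (drinfeld k H α⁻¹))

/-- The `π`-grouplike element `ℓ_α = S_{α⁻¹}(u_{α⁻¹})⁻¹ u_α`. -/
def ell (α : π) : H α :=
  Ring.inverse (sdrinfeld k H α) * drinfeld k H α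


/-- The R-matrix, with all arguments explicit. -/
def rmatrix (α β : π) : H α ⊗[k] H β := Rm α β

end QTHopfGCoalgebra

open QTHopfGCoalgebra

/-! ### Transport along equalities of indices -/

section Transport

variable {k : Type*} [CommSemiring k] {π : Type*} {H : π → Type*}
  [∀ α, Ring (H α)] [∀ α, Algebra k (H α)]

@[simp]
theorem gcast_rfl {a : π} (h : a = a) (x : H a) : gcast k H h x = x := rfl

@[simp]
theorem gcast_gcast {a b c : π} (h : a = b) (h' : b = c) (x : H a) :
    gcast k H h' (gcast k H h x) = gcast k H (h.trans h') x := by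
  subst h h'
  rfl

end Transport

/-! ### Convolution -/

namespace HopfGCoalgebra

variable {k : Type*} [Field k] {π : Type*} [Group π] {H : π → Type*}
  [∀ α, Ring (H α)] [∀ α, Algebra k (H α)] [HopfGCoalgebra k H]
  {A : Type*} [Ring A] [Algebra k A] {B : Type*} [Ring B] [Algebra k B]

/-- The comultiplication `H γ → H α ⊗ H β` attached to a factorization `α * β = γ`. -/
def comulOf {α β γ : π} (h : α * β = γ) : H γ →ₐ[k] H α ⊗[k] H β :=
  (Δ α β).comp (gcast k H h.symm : H γ →ₐ[k] H (α * β))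

theorem comulOf_rfl {α β : π} (x : H (α * β)) : comulOf (k := k) rfl x = Δ α β x := rfl

/-- The convolution product of linear maps with values in an algebra. -/
def conv {α β γ : π} (h : α * β = γ) (f : H α →ₗ[k] A) (g : H β →ₗ[k] A) : H γ →ₗ[k] A :=
  LinearMap.mul' k A ∘ₗ TensorProduct.map f g ∘ₗ (comulOf h).toLinearMap

theorem conv_apply {α β γ : π} (h : α * β = γ) (f : H α →ₗ[k] A) (g : H β →ₗ[k] A) (x : H γ) :
    conv h f g x = LinearMap.mul' k A (TensorProduct.map f g (comulOf h x)) := rfl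

theorem conv_apply_of_eq_sum {α β γ : π} (h : α * β = γ) (f : H α →ₗ[k] A) (g : H β →ₗ[k] A)
    {x : H γ} {ι : Type*} {s : Finset ι} {a : ι → H α} {b : ι → H β}
    (hx : comulOf (k := k) h x = ∑ i ∈ s, a i ⊗ₜ[k] b i) :
    conv h f g x = ∑ i ∈ s, f (a i) * g (b i) := by
  simp [conv_apply, hx]

/-- The unit of the convolution product. -/
def convUnit (k : Type*) [Field k] {π : Type*} [Group π] (H : π → Type*)
    [∀ α, Ring (H α)] [∀ α, Algebra k (H α)] [HopfGCoalgebra k H]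
    (A : Type*) [Ring A] [Algebra k A] : H (1 : π) →ₗ[k] A :=
  Algebra.linearMap k A ∘ₗ (ε (k := k) (H := H)).toLinearMap

theorem convUnit_apply (x : H (1 : π)) :
    convUnit k H A x = algebraMap k A (ε (k := k) (H := H) x) := rfl

theorem conv_assoc {α β γ μ ξ τ : π} (h₁ : α * β = μ) (h₂ : μ * γ = τ) (h₃ : β * γ = ξ)
    (h₄ : α * ξ = τ) (f : H α →ₗ[k] A) (g : H β →ₗ[k] A) (e : H γ →ₗ[k] A) :
    conv h₂ (conv h₁ f g) e = conv h₄ f (conv h₃ g e) := by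
  subst h₁ h₃ h₂
  have hc := coassoc (k := k) (H := H) α β γ
  have key : ∀ t : (H α ⊗[k] H β) ⊗[k] H γ,
      LinearMap.mul' k A (TensorProduct.map (LinearMap.mul' k A ∘ₗ TensorProduct.map f g) e t)
        = LinearMap.mul' k A (TensorProduct.map f (LinearMap.mul' k A ∘ₗ TensorProduct.map g e)
            (TensorProduct.assoc k _ _ _ t)) := by
    intro t
    induction t with
    | zero => simp
    | add x y hx hy => simp only [map_add, hx, hy]
    | tmul x c =>
      induction x with
      | zero => simp
      | add x y hx hy => simp only [map_add, TensorProduct.add_tmul, hx, hy]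
      | tmul a b => simp [mul_assoc]
  ext x
  have hx := LinearMap.congr_fun hc x
  simp only [LinearMap.comp_apply, LinearEquiv.coe_coe] at hx
  have h1 : conv rfl (conv rfl f g) e x = LinearMap.mul' k A (TensorProduct.map
      (LinearMap.mul' k A ∘ₗ TensorProduct.map f g) e (TensorProduct.map
        (Δ α β).toLinearMap LinearMap.id (Δ (α * β) γ x))) := by
    rw [← LinearMap.comp_apply (TensorProduct.map _ _), ← TensorProduct.map_comp]
    rfl
  rw [h1, key]
  erw [hx]
  rw [← LinearMap.comp_apply (TensorProduct.map _ _), ← TensorProduct.map_comp]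
  rfl

theorem conv_convUnit {α : π} (h : α * 1 = α) (f : H α →ₗ[k] A) :
    conv h f (convUnit k H A) = f := by
  ext x
  have hx := LinearMap.congr_fun (counit_right (k := k) (H := H) α) x
  have key : ∀ t : H α ⊗[k] H (1 : π),
      LinearMap.mul' k A (TensorProduct.map f (convUnit k H A) t)
        = f (TensorProduct.rid k (H α) (TensorProduct.map LinearMap.id ε.toLinearMap t)) := by
    intro t
    induction t with
    | zero => simp
    | add x y hx hy => simp only [map_add, hx, hy]
    | tmul a b => simp [convUnit_apply, Algebra.algebraMap_eq_smul_one]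
  rw [conv_apply, key]
  exact congrArg f hx

theorem convUnit_conv {α : π} (h : 1 * α = α) (f : H α →ₗ[k] A) :
    conv h (convUnit k H A) f = f := by
  ext x
  have hx := LinearMap.congr_fun (counit_left (k := k) (H := H) α) x
  have key : ∀ t : H (1 : π) ⊗[k] H α,
      LinearMap.mul' k A (TensorProduct.map (convUnit k H A) f t)
        = f (TensorProduct.lid k (H α) (TensorProduct.map ε.toLinearMap LinearMap.id t)) := by
    intro t
    induction t with
    | zero => simp
    | add x y hx hy => simp only [map_add, hx, hy]
    | tmul a b => simp [convUnit_apply, Algebra.algebraMap_eq_smul_one]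
  rw [conv_apply, key]
  exact congrArg f hx

theorem algHom_comp_conv (θ : A →ₐ[k] B) {α β γ : π} (h : α * β = γ) (f : H α →ₗ[k] A)
    (g : H β →ₗ[k] A) :
    θ.toLinearMap ∘ₗ conv h f g = conv h (θ.toLinearMap ∘ₗ f) (θ.toLinearMap ∘ₗ g) := by
  ext x
  obtain ⟨n, a, b, hx⟩ := TensorProduct.exists_sum_tmul_eq (comulOf (k := k) h x)
  simp [conv_apply_of_eq_sum _ _ _ hx]

theorem algHom_comp_convUnit (θ : A →ₐ[k] B) :
    θ.toLinearMap ∘ₗ convUnit k H A = convUnit k H B := by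
  ext x
  simp [convUnit_apply]

theorem mulLeft_comp_conv (c : A) {α β γ : π} (h : α * β = γ) (f : H α →ₗ[k] A)
    (g : H β →ₗ[k] A) :
    LinearMap.mulLeft k c ∘ₗ conv h f g = conv h (LinearMap.mulLeft k c ∘ₗ f) g := by
  ext x
  obtain ⟨n, a, b, hx⟩ := TensorProduct.exists_sum_tmul_eq (comulOf (k := k) h x)
  simp [conv_apply_of_eq_sum _ _ _ hx, mul_assoc]

theorem mulRight_comp_conv (c : A) {α β γ : π} (h : α * β = γ) (f : H α →ₗ[k] A)
    (g : H β →ₗ[k] A) :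
    LinearMap.mulRight k c ∘ₗ conv h f g = conv h f (LinearMap.mulRight k c ∘ₗ g) := by
  ext x
  obtain ⟨n, a, b, hx⟩ := TensorProduct.exists_sum_tmul_eq (comulOf (k := k) h x)
  simp [conv_apply_of_eq_sum _ _ _ hx, mul_assoc]

theorem conv_left_inverse_unique {α β : π} (h : β * α = 1) (h' : α * β = 1)
    {f f' : H β →ₗ[k] A} {g : H α →ₗ[k] A} (hf : conv h f g = convUnit k H A)
    (hf' : conv h' g f' = convUnit k H A) : f = f' := by
  rw [← conv_convUnit (mul_one β) f, ← hf', ← conv_assoc h (one_mul β), hf, convUnit_conv]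

/-! ### The antipode -/

/-- The antipode `H α → H β` for `α * β = 1`. -/
def antipodeOf {α β : π} (h : α * β = 1) : H α →ₗ[k] H β :=
  (gcast k H (inv_eq_of_mul_eq_one_right h)).toLinearMap ∘ₗ S α

theorem antipodeOf_conv_id {α β : π} (h : β * α = 1) :
    conv h (antipodeOf h) LinearMap.id = convUnit k H (H α) := by
  obtain rfl := eq_inv_of_mul_eq_one_left h
  ext x
  have hx := LinearMap.congr_fun (antipode_left (k := k) (H := H) α)
    (gcast k H (inv_mul_cancel α).symm x)
  simp only [LinearMap.comp_apply, AlgEquiv.toLinearMap_apply, gcast_gcast, gcast_rfl] at hx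
  exact hx

theorem id_conv_antipodeOf {α β : π} (h : α * β = 1) (h' : β * α = 1) :
    conv h LinearMap.id (antipodeOf h') = convUnit k H (H α) := by
  obtain rfl := eq_inv_of_mul_eq_one_right h
  ext x
  have hx := LinearMap.congr_fun (antipode_right (k := k) (H := H) α)
    (gcast k H (mul_inv_cancel α).symm x)
  simp only [LinearMap.comp_apply, AlgEquiv.toLinearMap_apply, gcast_gcast, gcast_rfl] at hx
  exact hx

theorem sum_antipodeOf_mul {α β : π} (h : β * α = 1) {x : H (1 : π)} {ι : Type*} {s : Finset ι}
    {a : ι → H β} {b : ι → H α} (hx : comulOf (k := k) h x = ∑ i ∈ s, a i ⊗ₜ[k] b i) :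
    ∑ i ∈ s, antipodeOf (k := k) h (a i) * b i = algebraMap k (H α) (ε (k := k) (H := H) x) := by
  rw [← convUnit_apply, ← antipodeOf_conv_id h, conv_apply_of_eq_sum _ _ _ hx]
  rfl

theorem sum_mul_antipodeOf {α β : π} (h : α * β = 1) (h' : β * α = 1) {x : H (1 : π)}
    {ι : Type*} {s : Finset ι} {a : ι → H α} {b : ι → H β}
    (hx : comulOf (k := k) h x = ∑ i ∈ s, a i ⊗ₜ[k] b i) :
    ∑ i ∈ s, a i * antipodeOf (k := k) h' (b i)
      = algebraMap k (H α) (ε (k := k) (H := H) x) := by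
  rw [← convUnit_apply, ← id_conv_antipodeOf h h', conv_apply_of_eq_sum _ _ _ hx]
  rfl

theorem algHom_antipodeOf_conv {α β : π} (h : β * α = 1) (θ : H α →ₐ[k] A) :
    conv h (θ.toLinearMap ∘ₗ antipodeOf h) θ.toLinearMap = convUnit k H A := by
  rw [← algHom_comp_convUnit θ, ← antipodeOf_conv_id h, algHom_comp_conv]
  rfl

theorem algHom_conv_antipodeOf {α β : π} (h : α * β = 1) (h' : β * α = 1) (θ : H α →ₐ[k] A) :
    conv h θ.toLinearMap (θ.toLinearMap ∘ₗ antipodeOf h') = convUnit k H A := by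
  rw [← algHom_comp_convUnit θ, ← id_conv_antipodeOf h h', algHom_comp_conv]
  rfl

theorem antipodeOf_mul {α β : π} (h : α * β = 1) (x y : H α) :
    antipodeOf (k := k) h (x * y) = antipodeOf (k := k) h y * antipodeOf (k := k) h x := by
  have h' : β * α = 1 := mul_eq_one_symm h
  have key : conv h (antipodeOf h ∘ₗ LinearMap.mulRight k y) LinearMap.id
      = LinearMap.mulLeft k (antipodeOf (k := k) h y) ∘ₗ convUnit k H (H β) := by
    ext z
    obtain ⟨n, a, b, hz⟩ := TensorProduct.exists_sum_tmul_eq (comulOf (k := k) h z)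
    let Q : H α →ₗ[k] H β :=
      ∑ i, LinearMap.mulRight k (b i) ∘ₗ antipodeOf h ∘ₗ LinearMap.mulLeft k (a i)
    have hQ : conv h Q LinearMap.id = (ε (k := k) (H := H) z) • convUnit k H (H β) := by
      ext v
      obtain ⟨m, c, d, hv⟩ := TensorProduct.exists_sum_tmul_eq (comulOf (k := k) h v)
      have hzv : comulOf (k := k) h (z * v)
          = ∑ p ∈ Finset.univ ×ˢ Finset.univ, (a p.1 * c p.2) ⊗ₜ[k] (b p.1 * d p.2) := by
        rw [map_mul, hz, hv, Finset.sum_mul_sum, Finset.sum_product]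
        simp
      have := sum_antipodeOf_mul h hzv
      rw [conv_apply_of_eq_sum _ _ _ hv]
      simp only [Q, LinearMap.sum_apply, LinearMap.comp_apply, LinearMap.mulRight_apply,
        LinearMap.mulLeft_apply, Finset.sum_mul, LinearMap.id_apply, LinearMap.smul_apply,
        convUnit_apply]
      rw [Finset.sum_comm, ← Finset.sum_product']
      simp only [mul_assoc] at this ⊢
      rw [this, map_mul, map_mul, Algebra.smul_def]
    have hQ' : Q = (ε (k := k) (H := H) z) • antipodeOf (k := k) h := by
      rw [← conv_convUnit (mul_one α) Q, ← id_conv_antipodeOf h' h,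
        ← conv_assoc h (one_mul α), hQ]
      ext v
      have := LinearMap.congr_fun (convUnit_conv (one_mul α) (antipodeOf (k := k) h)) v
      obtain ⟨m, c, d, hv⟩ := TensorProduct.exists_sum_tmul_eq (comulOf (k := k) (one_mul α) v)
      rw [conv_apply_of_eq_sum _ _ _ hv] at this ⊢
      simp only [LinearMap.smul_apply, smul_mul_assoc, ← Finset.smul_sum, this]
    rw [conv_apply_of_eq_sum _ _ _ hz]
    have := LinearMap.congr_fun hQ' y
    simp only [Q, LinearMap.sum_apply, LinearMap.comp_apply, LinearMap.mulRight_apply,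
        LinearMap.mulLeft_apply, LinearMap.smul_apply] at this
    simp [this, convUnit_apply, ← Algebra.commutes, Algebra.smul_def]
  have h2 : antipodeOf h ∘ₗ LinearMap.mulRight k y
      = LinearMap.mulLeft k (antipodeOf (k := k) h y) ∘ₗ antipodeOf (k := k) h := by
    rw [← conv_convUnit (mul_one α) (antipodeOf h ∘ₗ LinearMap.mulRight k y),
      ← id_conv_antipodeOf h' h, ← conv_assoc h (one_mul α), key, ← mulLeft_comp_conv,
      convUnit_conv]
  exact LinearMap.congr_fun h2 x

theorem antipodeOf_one {α β : π} (h : α * β = 1) : antipodeOf (k := k) h (1 : H α) = 1 := by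
  have h1 : comulOf (k := k) h (1 : H (1 : π)) = ∑ _i ∈ {()}, (1 : H α) ⊗ₜ[k] (1 : H β) := by
    simp [Algebra.TensorProduct.one_def]
  simpa using sum_antipodeOf_mul h h1

theorem counit_antipodeOf (h : (1 : π) * 1 = 1) (x : H (1 : π)) :
    ε (k := k) (antipodeOf (k := k) h x) = ε (k := k) (H := H) x := by
  have h1 := algHom_antipodeOf_conv h (ε (k := k) (H := H))
  have h2 : (ε (k := k) (H := H)).toLinearMap = convUnit k H k := by
    ext x
    simp [convUnit_apply]
  nth_rw 2 [h2] at h1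
  rw [conv_convUnit] at h1
  simpa [convUnit_apply] using LinearMap.congr_fun h1 x

theorem includeLeft_conv_includeRight {α β γ : π} (h : α * β = γ) :
    conv h (Algebra.TensorProduct.includeLeft : H α →ₐ[k] H α ⊗[k] H β).toLinearMap
      (Algebra.TensorProduct.includeRight : H β →ₐ[k] H α ⊗[k] H β).toLinearMap
      = (comulOf (k := k) h).toLinearMap := by
  ext x
  obtain ⟨n, a, b, hx⟩ := TensorProduct.exists_sum_tmul_eq (comulOf (k := k) h x)
  rw [conv_apply_of_eq_sum _ _ _ hx]
  simp [hx]

/-- The antipode is anti-comultiplicative. -/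
theorem comulOf_antipodeOf {α β γ α' β' γ' : π} (h : α * β = γ) (hγ : γ' * γ = 1)
    (hα : α' * α = 1) (hβ : β' * β = 1) (h' : β' * α' = γ') (x : H γ') :
    comulOf (k := k) h (antipodeOf (k := k) hγ x)
      = TensorProduct.comm k _ _
          (TensorProduct.map (antipodeOf hβ) (antipodeOf hα) (comulOf (k := k) h' x)) := by
  let i₁ : H α →ₐ[k] H α ⊗[k] H β := Algebra.TensorProduct.includeLeft
  let i₂ : H β →ₐ[k] H α ⊗[k] H β := Algebra.TensorProduct.includeRight
  have hγ' : γ * γ' = 1 := mul_eq_one_symm hγ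
  have hα' : α * α' = 1 := mul_eq_one_symm hα
  have hβ' : β * β' = 1 := mul_eq_one_symm hβ
  have hβγ : β * γ' = α' := by rw [← h', ← mul_assoc, hβ', one_mul]
  have h1 : (comulOf (k := k) h).toLinearMap ∘ₗ antipodeOf hγ
      = conv h' (i₂.toLinearMap ∘ₗ antipodeOf hβ) (i₁.toLinearMap ∘ₗ antipodeOf hα) := by
    refine conv_left_inverse_unique hγ hγ' (g := (comulOf (k := k) h).toLinearMap)
      (algHom_antipodeOf_conv hγ _) ?_
    rw [← includeLeft_conv_includeRight, conv_assoc h hγ' hβγ hα',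
      ← conv_assoc hβ' (one_mul α') h' hβγ, algHom_conv_antipodeOf hβ' hβ, convUnit_conv,
      algHom_conv_antipodeOf hα' hα]
  have hx := LinearMap.congr_fun h1 x
  obtain ⟨n, a, b, hs⟩ := TensorProduct.exists_sum_tmul_eq (comulOf (k := k) h' x)
  rw [conv_apply_of_eq_sum _ _ _ hs] at hx
  simp only [LinearMap.comp_apply, AlgHom.toLinearMap_apply] at hx
  rw [hx, hs]
  simp [i₁, i₂]

end HopfGCoalgebra

/-! ### Hit operators -/

namespace HopfGCoalgebra

variable {k : Type*} [Field k] {π : Type*} [Group π] {H : π → Type*}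
  [∀ α, Ring (H α)] [∀ α, Algebra k (H α)] [HopfGCoalgebra k H]
  {A : Type*} [Ring A] [Algebra k A]

/-- The operator `x ↦ q(x₂) x₁ : H γ → H α` for `q ∈ H β*`. -/
def hitRight {α β γ : π} (h : α * β = γ) (q : H β →ₗ[k] k) : H γ →ₗ[k] H α :=
  conv h LinearMap.id (Algebra.linearMap k (H α) ∘ₗ q)

/-- The operator `x ↦ f(x₁) x₂ : H γ → H β` for `f ∈ H α*`. -/
def hitLeft {α β γ : π} (h : α * β = γ) (f : H α →ₗ[k] k) : H γ →ₗ[k] H β :=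
  conv h (Algebra.linearMap k (H β) ∘ₗ f) LinearMap.id

theorem hitRight_of_eq_sum {α β γ : π} (h : α * β = γ) (q : H β →ₗ[k] k)
    {x : H γ} {ι : Type*} {s : Finset ι} {a : ι → H α} {b : ι → H β}
    (hx : comulOf (k := k) h x = ∑ i ∈ s, a i ⊗ₜ[k] b i) :
    hitRight h q x = ∑ i ∈ s, q (b i) • a i := by
  rw [hitRight, conv_apply_of_eq_sum _ _ _ hx]
  simp [Algebra.algebraMap_eq_smul_one]

theorem hitLeft_of_eq_sum {α β γ : π} (h : α * β = γ) (f : H α →ₗ[k] k)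
    {x : H γ} {ι : Type*} {s : Finset ι} {a : ι → H α} {b : ι → H β}
    (hx : comulOf (k := k) h x = ∑ i ∈ s, a i ⊗ₜ[k] b i) :
    hitLeft h f x = ∑ i ∈ s, f (a i) • b i := by
  rw [hitLeft, conv_apply_of_eq_sum _ _ _ hx]
  simp [Algebra.algebraMap_eq_smul_one]

theorem hitRight_eq_rid {α β γ : π} (h : α * β = γ) (q : H β →ₗ[k] k) (x : H γ) :
    hitRight h q x
      = TensorProduct.rid k (H α) (TensorProduct.map LinearMap.id q (comulOf (k := k) h x)) := by
  obtain ⟨n, a, b, hx⟩ := TensorProduct.exists_sum_tmul_eq (comulOf (k := k) h x)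
  rw [hitRight_of_eq_sum h q hx, hx]
  simp

theorem hitLeft_eq_lid {α β γ : π} (h : α * β = γ) (f : H α →ₗ[k] k) (x : H γ) :
    hitLeft h f x
      = TensorProduct.lid k (H β) (TensorProduct.map f LinearMap.id (comulOf (k := k) h x)) := by
  obtain ⟨n, a, b, hx⟩ := TensorProduct.exists_sum_tmul_eq (comulOf (k := k) h x)
  rw [hitLeft_of_eq_sum h f hx, hx]
  simp

theorem comp_hitRight {α β γ : π} (h : α * β = γ) (q : H β →ₗ[k] k) (F : H α →ₗ[k] A) :
    F ∘ₗ hitRight h q = conv h F (Algebra.linearMap k A ∘ₗ q) := by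
  ext x
  obtain ⟨n, a, b, hx⟩ := TensorProduct.exists_sum_tmul_eq (comulOf (k := k) h x)
  rw [LinearMap.comp_apply, hitRight_of_eq_sum h q hx, conv_apply_of_eq_sum _ _ _ hx]
  simp [Algebra.algebraMap_eq_smul_one]

theorem comp_hitLeft {α β γ : π} (h : α * β = γ) (f : H α →ₗ[k] k) (F : H β →ₗ[k] A) :
    F ∘ₗ hitLeft h f = conv h (Algebra.linearMap k A ∘ₗ f) F := by
  ext x
  obtain ⟨n, a, b, hx⟩ := TensorProduct.exists_sum_tmul_eq (comulOf (k := k) h x)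
  rw [LinearMap.comp_apply, hitLeft_of_eq_sum h f hx, conv_apply_of_eq_sum _ _ _ hx]
  simp [Algebra.algebraMap_eq_smul_one]

theorem hitRight_comp_hitRight {α β γ μ τ : π} (h₁ : α * β = μ) (h₂ : μ * γ = τ) {ξ : π}
    (h₃ : β * γ = ξ) (h₄ : α * ξ = τ) (q : H β →ₗ[k] k) (p : H γ →ₗ[k] k) :
    hitRight h₁ q ∘ₗ hitRight h₂ p = hitRight h₄ (conv h₃ q p) := by
  rw [comp_hitRight, hitRight, conv_assoc h₁ h₂ h₃ h₄, hitRight]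
  exact congrArg _ (algHom_comp_conv (Algebra.ofId k (H α)) h₃ q p).symm

theorem hitLeft_comp_hitRight {α β γ μ ξ τ : π} (h₁ : α * β = μ) (h₂ : μ * γ = τ)
    (h₃ : β * γ = ξ) (h₄ : α * ξ = τ) (f : H α →ₗ[k] k) (p : H γ →ₗ[k] k) :
    hitLeft h₁ f ∘ₗ hitRight h₂ p = hitRight h₃ p ∘ₗ hitLeft h₄ f := by
  rw [comp_hitRight, comp_hitLeft, hitLeft, hitRight, conv_assoc h₁ h₂ h₃ h₄]

theorem hitRight_smul_counit {α : π} (h : α * 1 = α) (c : k) :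
    hitRight h (c • (ε (k := k) (H := H)).toLinearMap) = c • LinearMap.id := by
  have := conv_convUnit h (LinearMap.id : H α →ₗ[k] H α)
  ext x
  obtain ⟨n, a, b, hx⟩ := TensorProduct.exists_sum_tmul_eq (comulOf (k := k) h x)
  have hx' := LinearMap.congr_fun this x
  rw [conv_apply_of_eq_sum _ _ _ hx] at hx'
  rw [hitRight_of_eq_sum h _ hx]
  simp only [convUnit_apply, Algebra.algebraMap_eq_smul_one, mul_smul_comm, mul_one,
    LinearMap.id_apply] at hx'
  simp [mul_smul, ← Finset.smul_sum, hx']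

theorem counit_hitLeft {q : H (1 : π) →ₗ[k] k} (h : (1 : π) * 1 = 1) (x : H (1 : π)) :
    ε (k := k) (hitLeft h q x) = q x := by
  have h1 := comp_hitLeft h q (ε (k := k) (H := H)).toLinearMap
  have h2 := conv_convUnit h q
  have h3 : (ε (k := k) (H := H)).toLinearMap = convUnit k H k := by
    ext x
    simp [convUnit_apply]
  have h4 : Algebra.linearMap k k ∘ₗ q = q := by ext; simp
  have := LinearMap.congr_fun h1 x
  rw [h4, h3, h2] at this
  simpa [convUnit_apply] using this

theorem hitRight_antipodeOf {α β γ α' β' γ' : π} (h : α * β = γ) (hγ : γ' * γ = 1)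
    (hα : α' * α = 1) (hβ : β' * β = 1) (h' : β' * α' = γ') (q : H β →ₗ[k] k) (x : H γ') :
    hitRight h q (antipodeOf (k := k) hγ x)
      = antipodeOf (k := k) hα (hitLeft h' (q ∘ₗ antipodeOf hβ) x) := by
  obtain ⟨n, a, b, hx⟩ := TensorProduct.exists_sum_tmul_eq (comulOf (k := k) h' x)
  rw [hitRight_eq_rid, comulOf_antipodeOf h hγ hα hβ h', hitLeft_of_eq_sum _ _ hx, hx]
  simp

theorem hitLeft_antipodeOf {α β γ α' β' γ' : π} (h : α * β = γ) (hγ : γ' * γ = 1)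
    (hα : α' * α = 1) (hβ : β' * β = 1) (h' : β' * α' = γ') (f : H α →ₗ[k] k) (x : H γ') :
    hitLeft h f (antipodeOf (k := k) hγ x)
      = antipodeOf (k := k) hβ (hitRight h' (f ∘ₗ antipodeOf hα) x) := by
  obtain ⟨n, a, b, hx⟩ := TensorProduct.exists_sum_tmul_eq (comulOf (k := k) h' x)
  rw [hitLeft_eq_lid, comulOf_antipodeOf h hγ hα hβ h', hitRight_of_eq_sum _ _ hx, hx]
  simp

variable (k H) in
/-- The square of the antipode of `H α`. -/
def antipodeSqOf (α : π) : H α →ₗ[k] H α :=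
  antipodeOf (inv_mul_cancel α) ∘ₗ antipodeOf (mul_inv_cancel α)

theorem hitRight_antipodeSqOf {α β γ : π} (h : α * β = γ) (q : H β →ₗ[k] k) (x : H γ) :
    hitRight h q (antipodeSqOf k H γ x)
      = antipodeSqOf k H α (hitRight h (q ∘ₗ antipodeSqOf k H β) x) := by
  have h' : β⁻¹ * α⁻¹ = γ⁻¹ := by rw [← h, mul_inv_rev]
  rw [antipodeSqOf, LinearMap.comp_apply,
    hitRight_antipodeOf h (inv_mul_cancel γ) (inv_mul_cancel α) (inv_mul_cancel β) h',
    hitLeft_antipodeOf h' (mul_inv_cancel γ) (mul_inv_cancel β) (mul_inv_cancel α) h]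
  rfl

/-- `S(y₂) S²(y₁) = ε(y)`. -/
theorem sum_antipodeOf_mul_antipodeSqOf {α β : π} (h : α * β = 1) (h' : β * α = 1)
    {x : H (1 : π)} {ι : Type*} {s : Finset ι} {a : ι → H α} {b : ι → H β}
    (hx : comulOf (k := k) h x = ∑ i ∈ s, a i ⊗ₜ[k] b i) :
    ∑ i ∈ s, antipodeOf (k := k) h' (b i) * antipodeSqOf k H α (a i)
      = algebraMap k (H α) (ε (k := k) (H := H) x) := by
  obtain rfl := eq_inv_of_mul_eq_one_right h
  have := congrArg (antipodeOf (k := k) h') (sum_antipodeOf_mul h hx)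
  rw [map_sum] at this
  simpa [antipodeOf_mul, antipodeOf_one, Algebra.algebraMap_eq_smul_one, antipodeSqOf] using this

end HopfGCoalgebra

/-! ### Existence of right integrals -/

namespace HopfGCoalgebra

variable {k : Type*} [Field k] {π : Type*} [Group π] {H : π → Type*}
  [∀ α, Ring (H α)] [∀ α, Algebra k (H α)] [HopfGCoalgebra k H]

theorem hitRight_sum {α β γ : π} (h : α * β = γ) {ι : Type*} (s : Finset ι)
    (q : ι → H β →ₗ[k] k) : hitRight h (∑ i ∈ s, q i) = ∑ i ∈ s, hitRight h (q i) := by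
  ext x
  obtain ⟨n, a, b, hx⟩ := TensorProduct.exists_sum_tmul_eq (comulOf (k := k) h x)
  simp only [hitRight_of_eq_sum h _ hx, LinearMap.sum_apply, Finset.sum_smul]
  rw [Finset.sum_comm]

theorem hitRight_mul {α β γ : π} (h : α * β = γ) (q : H β →ₗ[k] k) (z x : H γ)
    {ι : Type*} {s : Finset ι} {a : ι → H α} {b : ι → H β}
    (hx : comulOf (k := k) h x = ∑ i ∈ s, a i ⊗ₜ[k] b i) :
    hitRight h q (z * x) = ∑ i ∈ s, hitRight h (q ∘ₗ LinearMap.mulRight k (b i)) z * a i := by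
  obtain ⟨n, c, d, hz⟩ := TensorProduct.exists_sum_tmul_eq (comulOf (k := k) h z)
  have hzx : comulOf (k := k) h (z * x)
      = ∑ p ∈ Finset.univ ×ˢ s, (c p.1 * a p.2) ⊗ₜ[k] (d p.1 * b p.2) := by
    rw [map_mul, hz, hx, Finset.sum_mul_sum, Finset.sum_product]
    simp
  rw [hitRight_of_eq_sum h q hzx, Finset.sum_product, Finset.sum_comm]
  simp [hitRight_of_eq_sum h _ hz, Finset.sum_mul]

theorem linearMap_comp_sum {M N P : Type*} [AddCommGroup M] [Module k M] [AddCommGroup N]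
    [Module k N] [AddCommGroup P] [Module k P] {ι : Type*} (s : Finset ι) (f : N →ₗ[k] P)
    (g : ι → M →ₗ[k] N) : f ∘ₗ ∑ i ∈ s, g i = ∑ i ∈ s, f ∘ₗ g i := by
  ext
  simp

theorem linearMap_sum_comp {M N P : Type*} [AddCommGroup M] [Module k M] [AddCommGroup N]
    [Module k N] [AddCommGroup P] [Module k P] {ι : Type*} (s : Finset ι) (f : ι → N →ₗ[k] P)
    (g : M →ₗ[k] N) : (∑ i ∈ s, f i) ∘ₗ g = ∑ i ∈ s, f i ∘ₗ g := by
  ext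
  simp

theorem sum_repr_mul_apply_mul {A : Type*} [Ring A] [Algebra k A] {ι : Type*} [Fintype ι]
    (e : Module.Basis ι k A) (p : A →ₗ[k] k) (s t : A) :
    ∑ l, e.repr s l * p (e l * t) = p (s * t) := by
  have := congrArg (fun z => p (z * t)) (e.sum_repr s)
  simpa only [Finset.sum_mul, map_sum, smul_mul_assoc, map_smul, smul_eq_mul] using this

theorem sum_conv_mulLeft_antipodeSqOf {α β : π} (h : β * α = 1) (h' : α * β = 1)
    {ι : Type*} [Fintype ι] (e : Module.Basis ι k (H β)) (p : H β →ₗ[k] k) (c : H β) :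
    ∑ l, conv h ((p ∘ₗ LinearMap.mulLeft k (e l)) ∘ₗ LinearMap.mulRight k c ∘ₗ antipodeSqOf k H β)
        (e.coord l ∘ₗ antipodeOf h') = p c • (ε (k := k) (H := H)).toLinearMap := by
  ext x
  obtain ⟨n, a, b, hx⟩ := TensorProduct.exists_sum_tmul_eq (comulOf (k := k) h x)
  have hsum := sum_antipodeOf_mul_antipodeSqOf h h' hx
  simp only [LinearMap.sum_apply, conv_apply_of_eq_sum _ _ _ hx, LinearMap.comp_apply]
  rw [Finset.sum_comm]
  have : ∀ i, ∑ l, p (LinearMap.mulLeft k (e l) (LinearMap.mulRight k c (antipodeSqOf k H β (a i))))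
      * e.coord l (antipodeOf (k := k) h' (b i))
      = p (antipodeOf (k := k) h' (b i) * antipodeSqOf k H β (a i) * c) := by
    intro i
    rw [mul_assoc, ← sum_repr_mul_apply_mul e]
    simp [mul_comm]
  simp only [this]
  rw [← map_sum, ← Finset.sum_mul, hsum]
  simp [Algebra.algebraMap_eq_smul_one, mul_comm]

theorem sum_conv_antipodeOf_mulLeft {α β : π} (h : α * β = 1)
    {ι : Type*} [Fintype ι] (e : Module.Basis ι k (H β)) (p : H β →ₗ[k] k) :
    ∑ l, conv h (e.coord l ∘ₗ antipodeOf h) (p ∘ₗ LinearMap.mulLeft k (e l))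
      = p 1 • (ε (k := k) (H := H)).toLinearMap := by
  ext x
  obtain ⟨n, a, b, hx⟩ := TensorProduct.exists_sum_tmul_eq (comulOf (k := k) h x)
  have hsum := sum_antipodeOf_mul h hx
  simp only [LinearMap.sum_apply, conv_apply_of_eq_sum _ _ _ hx, LinearMap.comp_apply]
  rw [Finset.sum_comm]
  have : ∀ i, ∑ l, e.coord l (antipodeOf (k := k) h (a i)) * p (LinearMap.mulLeft k (e l) (b i))
      = p (antipodeOf (k := k) h (a i) * b i) := by
    intro i
    rw [← sum_repr_mul_apply_mul e]
    rfl
  simp only [this]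
  rw [← map_sum, hsum]
  simp [Algebra.algebraMap_eq_smul_one, mul_comm]

theorem mulRight_hitRight_comp_antipodeSqOf {α β γ : π} (h : α * β = γ) (h' : γ * β⁻¹ = α)
    {ι : Type*} [Fintype ι] (e : Module.Basis ι k (H β)) (p : H β →ₗ[k] k) (x : H γ) :
    LinearMap.mulRight k (hitRight h p x) ∘ₗ antipodeSqOf k H α
      = ∑ l, hitRight h (p ∘ₗ LinearMap.mulLeft k (e l)) ∘ₗ LinearMap.mulRight k x ∘ₗ
          antipodeSqOf k H γ ∘ₗ hitRight h' (e.coord l ∘ₗ antipodeOf (inv_mul_cancel β)) := by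
  ext y
  obtain ⟨n, a, b, hx⟩ := TensorProduct.exists_sum_tmul_eq (comulOf (k := k) h x)
  have hy : ∀ l i, hitRight h ((p ∘ₗ LinearMap.mulLeft k (e l)) ∘ₗ LinearMap.mulRight k (b i))
        (antipodeSqOf k H γ (hitRight h' (e.coord l ∘ₗ antipodeOf (inv_mul_cancel β)) y))
      = antipodeSqOf k H α (hitRight (mul_one α) (conv (mul_inv_cancel β)
        ((p ∘ₗ LinearMap.mulLeft k (e l)) ∘ₗ LinearMap.mulRight k (b i) ∘ₗ antipodeSqOf k H β)
        (e.coord l ∘ₗ antipodeOf (inv_mul_cancel β))) y) := by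
    intro l i
    rw [hitRight_antipodeSqOf, ← LinearMap.comp_apply (hitRight h _),
      hitRight_comp_hitRight h h' (mul_inv_cancel β) (mul_one α)]
    rfl
  simp only [LinearMap.sum_apply, LinearMap.comp_apply, LinearMap.mulRight_apply,
    hitRight_mul h _ _ _ hx, hy]
  rw [Finset.sum_comm]
  simp only [← Finset.sum_mul, ← map_sum, ← LinearMap.sum_apply, ← hitRight_sum,
    sum_conv_mulLeft_antipodeSqOf, hitRight_smul_counit]
  simp [hitRight_of_eq_sum h p hx, Finset.mul_sum]

/-- The family of linear forms `x ↦ Tr(y ↦ (f ⊗ id) Δ(S²(y) x))`. -/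
def traceForm (f : H (1 : π) →ₗ[k] k) (α : π) : H α →ₗ[k] k :=
  LinearMap.trace k (H α) ∘ₗ LinearMap.compRight k (hitLeft (one_mul α) f) ∘ₗ
    LinearMap.lcomp k (H α) (antipodeSqOf k H α) ∘ₗ (LinearMap.mul k (H α)).flip

theorem traceForm_apply (f : H (1 : π) →ₗ[k] k) (α : π) (x : H α) :
    traceForm f α x = LinearMap.trace k (H α)
      (hitLeft (one_mul α) f ∘ₗ LinearMap.mulRight k x ∘ₗ antipodeSqOf k H α) := rfl

theorem traceForm_hitRight [∀ α, FiniteDimensional k (H α)] (f : H (1 : π) →ₗ[k] k) {α β γ : π}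
    (h : α * β = γ) (p : H β →ₗ[k] k) (x : H γ) :
    traceForm f α (hitRight h p x) = p 1 * traceForm f γ x := by
  have h' : γ * β⁻¹ = α := by rw [← h, mul_inv_cancel_right]
  let e := Module.finBasis k (H β)
  rw [traceForm_apply, mulRight_hitRight_comp_antipodeSqOf h h' e, linearMap_comp_sum, map_sum]
  have hl : ∀ l, LinearMap.trace k (H α) (hitLeft (one_mul α) f ∘ₗ
        hitRight h (p ∘ₗ LinearMap.mulLeft k (e l)) ∘ₗ LinearMap.mulRight k x ∘ₗ
          antipodeSqOf k H γ ∘ₗ hitRight h' (e.coord l ∘ₗ antipodeOf (inv_mul_cancel β)))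
      = LinearMap.trace k (H γ) (hitRight (mul_one γ) (conv (inv_mul_cancel β)
          (e.coord l ∘ₗ antipodeOf (inv_mul_cancel β)) (p ∘ₗ LinearMap.mulLeft k (e l))) ∘ₗ
          (hitLeft (one_mul γ) f ∘ₗ LinearMap.mulRight k x ∘ₗ antipodeSqOf k H γ)) := by
    intro l
    rw [← hitRight_comp_hitRight h' h (inv_mul_cancel β) (mul_one γ), ← LinearMap.comp_assoc,
      hitLeft_comp_hitRight (one_mul α) h h (one_mul γ), LinearMap.comp_assoc, LinearMap.comp_assoc]
    exact (LinearMap.trace_comp_comm' (hitRight h (p ∘ₗ LinearMap.mulLeft k (e l)) ∘ₗ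
      hitLeft (one_mul γ) f ∘ₗ LinearMap.mulRight k x ∘ₗ antipodeSqOf k H γ) _).symm
  simp only [hl]
  rw [← map_sum, ← linearMap_sum_comp, ← hitRight_sum, sum_conv_antipodeOf_mulLeft,
    hitRight_smul_counit, LinearMap.smul_comp, LinearMap.id_comp, map_smul, traceForm_apply,
    smul_eq_mul]

theorem isRightIntegral_of_apply_hitRight {lam : ∀ α : π, H α →ₗ[k] k}
    (hlam : ∀ (α β : π) (p : H β →ₗ[k] k) (x : H (α * β)),
      lam α (hitRight rfl p x) = p 1 * lam (α * β) x) : IsRightIntegral k H lam := by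
  intro α β x
  rw [← sub_eq_zero, ← Module.forall_dual_apply_eq_zero_iff k]
  intro p
  obtain ⟨n, a, b, hx⟩ := TensorProduct.exists_sum_tmul_eq (comulOf (k := k) rfl x)
  have := hlam α β p x
  rw [hitRight_of_eq_sum _ _ hx] at this
  rw [comulOf_rfl] at hx
  rw [hx]
  simp only [map_sum, map_smul, map_sub, TensorProduct.map_tmul, TensorProduct.lid_tmul,
    LinearMap.id_apply, smul_eq_mul] at this ⊢
  rw [mul_comm _ (p 1), ← this, sub_eq_zero]
  exact Finset.sum_congr rfl fun i _ => mul_comm _ _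

theorem isRightIntegral_traceForm [∀ α, FiniteDimensional k (H α)] (f : H (1 : π) →ₗ[k] k) :
    IsRightIntegral k H (traceForm f) :=
  isRightIntegral_of_apply_hitRight fun _ _ p x => traceForm_hitRight f rfl p x

theorem sum_traceForm_coord {ι : Type*} [Fintype ι] [DecidableEq ι]
    (e : Module.Basis ι k (H (1 : π))) :
    ∑ j, traceForm (e.coord j) 1 (antipodeOf (k := k) (mul_one (1 : π)) (e j)) = 1 := by
  have : Module.Finite k (H (1 : π)) := Module.Finite.of_basis e
  let Sa : H (1 : π) →ₗ[k] H (1 : π) := antipodeOf (k := k) (mul_one (1 : π))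
  let D : H (1 : π) →ₗ[k] H (1 : π) ⊗[k] H (1 : π) :=
    (comulOf (k := k) (mul_one (1 : π))).toLinearMap
  let μ : H (1 : π) ⊗[k] H (1 : π) →ₗ[k] H (1 : π) :=
    LinearMap.mul' k (H 1) ∘ₗ TensorProduct.map LinearMap.id Sa
  have hsq : ∀ y, antipodeSqOf k H 1 y = Sa (Sa y) := by
    intro y
    have : ∀ (a : π) (h1 : 1 * a = 1) (h2 : a * 1 = 1) (y : H (1 : π)),
        antipodeOf (k := k) h2 (antipodeOf (k := k) h1 y) = Sa (Sa y) := by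
      intro a h1 h2 y
      obtain rfl : a = 1 := by simpa using h2
      rfl
    exact this _ (mul_inv_cancel 1) (inv_mul_cancel 1) y
  have h1 : LinearMap.trace k (H 1 ⊗[k] H 1) (D ∘ₗ Sa ∘ₗ μ)
      = ∑ j, traceForm (e.coord j) 1 (Sa (e j)) := by
    have hcoord : ∀ (t : H (1 : π) ⊗[k] H (1 : π)) (j i : ι),
        (e.tensorProduct e).repr t (j, i) = e.coord i (TensorProduct.lid k _
          (TensorProduct.map (e.coord j) LinearMap.id t)) := by
      intro t j i
      induction t with
      | zero => simp
      | add x y hx hy => simp only [map_add, Finsupp.add_apply, hx, hy]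
      | tmul a b => simp [mul_comm]
    rw [LinearMap.trace_eq_matrix_trace k (e.tensorProduct e), Matrix.trace, Fintype.sum_prod_type]
    refine Finset.sum_congr rfl fun j _ => ?_
    rw [traceForm_apply, LinearMap.trace_eq_matrix_trace k e, Matrix.trace]
    refine Finset.sum_congr rfl fun i _ => ?_
    rw [Matrix.diag_apply, Matrix.diag_apply, LinearMap.toMatrix_apply, LinearMap.toMatrix_apply,
      hcoord]
    simp only [LinearMap.comp_apply, hsq, LinearMap.mulRight_apply]
    rw [hitLeft_eq_lid, ← antipodeOf_mul]
    simp [D, μ, Sa]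
  change ∑ j, traceForm (e.coord j) 1 (Sa (e j)) = 1
  rw [← h1, LinearMap.trace_comp_comm']
  have h2 : (Sa ∘ₗ μ) ∘ₗ D
      = LinearMap.toSpanSingleton k (H 1) 1 ∘ₗ (ε (k := k) (H := H)).toLinearMap := by
    ext x
    have hx : μ (D x) = algebraMap k (H 1) (ε (k := k) (H := H) x) :=
      LinearMap.congr_fun (id_conv_antipodeOf (k := k) (H := H) (mul_one (1 : π)) (mul_one 1)) x
    rw [LinearMap.comp_apply, LinearMap.comp_apply, hx]
    simp [Algebra.algebraMap_eq_smul_one, Sa, antipodeOf_one]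
  rw [h2, LinearMap.trace_comp_comm']
  have h3 : (ε (k := k) (H := H)).toLinearMap ∘ₗ LinearMap.toSpanSingleton k (H 1) 1
      = LinearMap.id := by
    ext
    simp
  rw [h3, LinearMap.trace_id]
  simp

variable (k H) in
theorem exists_isRightIntegral_ne_zero [∀ α, FiniteDimensional k (H α)] :
    ∃ lam : ∀ α : π, H α →ₗ[k] k, IsRightIntegral k H lam ∧ lam 1 ≠ 0 := by
  by_contra! hc
  have := sum_traceForm_coord (k := k) (H := H) (Module.finBasis k (H 1))
  simp [hc _ (isRightIntegral_traceForm _)] at this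

end HopfGCoalgebra

/-! ### The left integral dual to a right integral -/

namespace HopfGCoalgebra

variable {k : Type*} [Field k] {π : Type*} [Group π] {H : π → Type*}
  [∀ α, Ring (H α)] [∀ α, Algebra k (H α)] [HopfGCoalgebra k H]
  {A : Type*} [Ring A] [Algebra k A]

theorem conv_sum {α β γ : π} (h : α * β = γ) {ι : Type*} (s : Finset ι) (f : H α →ₗ[k] A)
    (g : ι → H β →ₗ[k] A) : conv h f (∑ i ∈ s, g i) = ∑ i ∈ s, conv h f (g i) := by
  ext x
  obtain ⟨n, a, b, hx⟩ := TensorProduct.exists_sum_tmul_eq (comulOf (k := k) h x)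
  simp only [conv_apply_of_eq_sum _ _ _ hx, LinearMap.sum_apply, Finset.mul_sum]
  rw [Finset.sum_comm]

variable {lam : ∀ α : π, H α →ₗ[k] k}

theorem IsRightIntegral.hitLeft_eq (hlam : IsRightIntegral k H lam) {α β γ : π} (h : α * β = γ)
    (x : H γ) : hitLeft h (lam α) x = lam γ x • (1 : H β) := by
  subst h
  rw [hitLeft_eq_lid]
  exact hlam α β x

/-- `y₁ λ(S(y₂) x) = λ(S(y) x₁) x₂`. -/
theorem IsRightIntegral.id_conv_eq (hlam : IsRightIntegral k H lam) (h : (1 : π) * 1 = 1)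
    (y : H (1 : π)) {x : H (1 : π)} {n : ℕ} {a b : Fin n → H (1 : π)}
    (hx : comulOf (k := k) h x = ∑ i, a i ⊗ₜ[k] b i) :
    conv h LinearMap.id (Algebra.linearMap k (H 1) ∘ₗ lam 1 ∘ₗ LinearMap.mulRight k x ∘ₗ
        antipodeOf h) y = ∑ i, lam 1 (antipodeOf (k := k) h y * a i) • b i := by
  have hG : Algebra.linearMap k (H 1) ∘ₗ lam 1 ∘ₗ LinearMap.mulRight k x ∘ₗ antipodeOf h
      = ∑ i, conv h (LinearMap.mulRight k (b i) ∘ₗ antipodeOf h)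
          (Algebra.linearMap k (H 1) ∘ₗ lam 1 ∘ₗ LinearMap.mulRight k (a i) ∘ₗ antipodeOf h) := by
    ext z
    obtain ⟨m, c, d, hz⟩ := TensorProduct.exists_sum_tmul_eq (comulOf (k := k) h z)
    have hzx : comulOf (k := k) h (antipodeOf (k := k) h z * x)
        = ∑ p ∈ Finset.univ ×ˢ Finset.univ, (antipodeOf (k := k) h (d p.1) * a p.2) ⊗ₜ[k]
            (antipodeOf (k := k) h (c p.1) * b p.2) := by
      rw [map_mul, comulOf_antipodeOf h h h h h, hz, hx]
      simp only [map_sum, TensorProduct.map_tmul, TensorProduct.comm_tmul]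
      rw [Finset.sum_mul_sum, Finset.sum_product]
      simp
    have := hlam.hitLeft_eq h (antipodeOf (k := k) h z * x)
    rw [hitLeft_of_eq_sum h _ hzx, Finset.sum_product, Finset.sum_comm] at this
    simp only [LinearMap.sum_apply, conv_apply_of_eq_sum _ _ _ hz]
    simpa [Algebra.algebraMap_eq_smul_one] using this.symm
  have hcomm : ∀ c : H (1 : π), LinearMap.mulRight k c ∘ₗ convUnit k H (H 1)
      = LinearMap.mulLeft k c ∘ₗ convUnit k H (H 1) := by
    intro c
    ext z
    simp [convUnit_apply, Algebra.commutes]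
  rw [hG, conv_sum, LinearMap.sum_apply]
  refine Finset.sum_congr rfl fun i _ => ?_
  rw [← conv_assoc h h h h, ← mulRight_comp_conv, id_conv_antipodeOf h h, hcomm,
    ← mulLeft_comp_conv, convUnit_conv]
  simp [Algebra.algebraMap_eq_smul_one]

theorem IsRightIntegral.apply_antipodeOf_hitLeft_mul (hlam : IsRightIntegral k H lam)
    (h : (1 : π) * 1 = 1) (q : H (1 : π) →ₗ[k] k) (y x : H (1 : π)) :
    lam 1 (antipodeOf (k := k) h (hitLeft h q y) * x)
      = lam 1 (antipodeOf (k := k) h y * hitRight h q x) := by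
  obtain ⟨n, a, b, hx⟩ := TensorProduct.exists_sum_tmul_eq (comulOf (k := k) h x)
  obtain ⟨m, c, d, hy⟩ := TensorProduct.exists_sum_tmul_eq (comulOf (k := k) h y)
  have := congrArg q (hlam.id_conv_eq h y hx)
  rw [conv_apply_of_eq_sum _ _ _ hy] at this
  rw [hitLeft_of_eq_sum _ _ hy, hitRight_of_eq_sum _ _ hx]
  simp only [map_sum, map_smul, Finset.sum_mul, Finset.mul_sum, smul_mul_assoc, mul_smul_comm]
  simpa [Algebra.algebraMap_eq_smul_one, mul_comm] using this

theorem IsRightIntegral.eq_zero_of_apply_antipodeOf_mul [∀ α, FiniteDimensional k (H α)]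
    (hlam : IsRightIntegral k H lam) (hne : lam 1 ≠ 0) (h : (1 : π) * 1 = 1) {y : H (1 : π)}
    (hy : ∀ x, lam 1 (antipodeOf (k := k) h y * x) = 0) : y = 0 := by
  have hstable : ∀ {y : H (1 : π)}, (∀ x, lam 1 (antipodeOf (k := k) h y * x) = 0) →
      ∀ (q : H (1 : π) →ₗ[k] k) x, lam 1 (antipodeOf (k := k) h (hitLeft h q y) * x) = 0 := by
    intro y hy q x
    rw [hlam.apply_antipodeOf_hitLeft_mul, hy]
  have hcounit : ∀ {y : H (1 : π)}, (∀ x, lam 1 (antipodeOf (k := k) h y * x) = 0) →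
      ε (k := k) (H := H) y = 0 := by
    intro y hy
    by_contra hε
    apply hne
    ext x
    obtain ⟨n, c, d, hs⟩ := TensorProduct.exists_sum_tmul_eq (comulOf (k := k) h y)
    let e := Module.finBasis k (H (1 : π))
    have h1 := congrArg (fun z => lam 1 (antipodeOf (k := k) h z * x)) (sum_antipodeOf_mul h hs)
    have h2 : ∀ j, antipodeOf (k := k) h (d j) * antipodeOf (k := k) h
          (antipodeOf (k := k) h (c j)) = ∑ i, antipodeOf (k := k) h (e.coord i (c j) • d j) *
            antipodeOf (k := k) h (antipodeOf (k := k) h (e i)) := by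
      intro j
      conv_lhs => rw [← e.sum_repr (c j)]
      simp only [map_sum, map_smul, Finset.mul_sum, mul_smul_comm, smul_mul_assoc,
        Module.Basis.coord_apply]
    simp only [map_sum, antipodeOf_mul, h2] at h1
    rw [Finset.sum_comm] at h1
    simp only [← Finset.sum_mul, ← map_sum, ← hitLeft_of_eq_sum h _ hs] at h1
    simp only [Finset.sum_mul, mul_assoc, map_sum, hstable hy] at h1
    simpa [Algebra.algebraMap_eq_smul_one, antipodeOf_one, hε] using h1
  rw [← Module.forall_dual_apply_eq_zero_iff k]
  intro q
  rw [← counit_hitLeft h]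
  exact hcounit (hstable hy q)

/-- A nonzero right integral has a left integral of `H 1` on which it takes the value `1`. -/
theorem IsRightIntegral.exists_leftIntegral [∀ α, FiniteDimensional k (H α)]
    (hlam : IsRightIntegral k H lam) (hne : lam 1 ≠ 0) :
    ∃ Λ : H (1 : π), (∀ x, x * Λ = ε (k := k) (H := H) x • Λ) ∧ lam 1 Λ = 1 := by
  have h : (1 : π) * 1 = 1 := mul_one 1
  let B : H (1 : π) →ₗ[k] Module.Dual k (H (1 : π)) :=
    LinearMap.compRight k (lam 1) ∘ₗ LinearMap.mul k (H 1) ∘ₗ antipodeOf h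
  have hB : ∀ y x, B y x = lam 1 (antipodeOf (k := k) h y * x) := fun _ _ => rfl
  have hinj : Function.Injective B := by
    rw [injective_iff_map_eq_zero]
    intro y hy
    exact hlam.eq_zero_of_apply_antipodeOf_mul hne h fun x => by rw [← hB, hy]; rfl
  have hS : Function.Surjective (antipodeOf (k := k) (H := H) h) := by
    rw [← LinearMap.injective_iff_surjective]
    exact Function.Injective.of_comp (f := LinearMap.compRight k (lam 1) ∘ₗ LinearMap.mul k (H 1))
      hinj
  obtain ⟨Λ, hΛ⟩ := LinearMap.flip_surjective_iff₁.2 hinj (ε (k := k) (H := H)).toLinearMap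
  have hΛ' : ∀ y, lam 1 (y * Λ) = ε (k := k) (H := H) y := by
    intro y
    obtain ⟨z, rfl⟩ := hS y
    rw [counit_antipodeOf]
    exact LinearMap.congr_fun hΛ z
  have hflip : Function.Injective B.flip := by
    rw [LinearMap.flip_injective_iff₁]
    exact (LinearMap.injective_iff_surjective_of_finrank_eq_finrank
      (Subspace.dual_finrank_eq).symm).1 hinj
  refine ⟨Λ, fun x => hflip ?_, by simpa using hΛ' 1⟩
  ext y
  rw [LinearMap.flip_apply, LinearMap.flip_apply, hB, hB, ← mul_assoc, mul_smul_comm, map_smul,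
    hΛ', hΛ', map_mul, mul_comm, smul_eq_mul]

end HopfGCoalgebra

/-! ### Commutation relations for left integrals -/

namespace HopfGCoalgebra

variable {k : Type*} [Field k] {π : Type*} [Group π] {H : π → Type*}
  [∀ α, Ring (H α)] [∀ α, Algebra k (H α)] [HopfGCoalgebra k H]

/-- `(1 ⊗ b) Δ(Λ) = (S(b) ⊗ 1) Δ(Λ)` for a left integral `Λ`. -/
theorem one_tmul_mul_comulOf {Λ : H (1 : π)} (hΛ : ∀ x, x * Λ = ε (k := k) (H := H) x • Λ)
    {α β : π} (h : α * β = 1) (h' : β * α = 1) (b : H β) :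
    ((1 : H α) ⊗ₜ[k] b) * comulOf (k := k) h Λ
      = (antipodeOf (k := k) h' b ⊗ₜ[k] (1 : H β)) * comulOf (k := k) h Λ := by
  let i₁ : H α →ₐ[k] H α ⊗[k] H β := Algebra.TensorProduct.includeLeft
  let i₂ : H β →ₐ[k] H α ⊗[k] H β := Algebra.TensorProduct.includeRight
  let T := comulOf (k := k) h Λ
  have h1 : conv (mul_one β) (i₁.toLinearMap ∘ₗ antipodeOf h') (comulOf (k := k) h).toLinearMap
      = i₂.toLinearMap := by
    rw [← includeLeft_conv_includeRight, ← conv_assoc h' (one_mul β) h (mul_one β),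
      algHom_antipodeOf_conv, convUnit_conv]
  have h2 : LinearMap.mulRight k T ∘ₗ (comulOf (k := k) h).toLinearMap
      = LinearMap.mulRight k T ∘ₗ convUnit k H (H α ⊗[k] H β) := by
    ext x
    have := congrArg (comulOf (k := k) h) (hΛ x)
    rw [map_mul, map_smul] at this
    simpa [convUnit_apply, Algebra.algebraMap_eq_smul_one] using this
  have h3 : LinearMap.mulRight k T ∘ₗ i₂.toLinearMap
      = LinearMap.mulRight k T ∘ₗ i₁.toLinearMap ∘ₗ antipodeOf h' := by
    rw [← h1, mulRight_comp_conv, h2, ← mulRight_comp_conv, conv_convUnit]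
  exact LinearMap.congr_fun h3 b

/-- `Δ(Λ) (c ⊗ 1) = ν(c₁) Δ(Λ) (1 ⊗ S(c₂))` for a left integral `Λ` with `Λ x = ν(x) Λ`. -/
theorem comulOf_mul_tmul_one {Λ : H (1 : π)} {ν : H (1 : π) →ₐ[k] k}
    (hΛ : ∀ x, Λ * x = ν x • Λ) {α β : π} (h : α * β = 1) (c : H α) :
    comulOf (k := k) h Λ * (c ⊗ₜ[k] (1 : H β)) = comulOf (k := k) h Λ * ((1 : H α) ⊗ₜ[k]
      conv (one_mul α) (Algebra.linearMap k (H β) ∘ₗ ν.toLinearMap) (antipodeOf h) c) := by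
  let i₁ : H α →ₐ[k] H α ⊗[k] H β := Algebra.TensorProduct.includeLeft
  let i₂ : H β →ₐ[k] H α ⊗[k] H β := Algebra.TensorProduct.includeRight
  let T := comulOf (k := k) h Λ
  have h' : β * α = 1 := mul_eq_one_symm h
  have h1 : conv (one_mul α) (comulOf (k := k) h).toLinearMap (i₂.toLinearMap ∘ₗ antipodeOf h)
      = i₁.toLinearMap := by
    rw [← includeLeft_conv_includeRight, conv_assoc h (one_mul α) h' (mul_one α),
      algHom_conv_antipodeOf, conv_convUnit]
  have h2 : LinearMap.mulLeft k T ∘ₗ (comulOf (k := k) h).toLinearMap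
      = LinearMap.mulLeft k T ∘ₗ i₂.toLinearMap ∘ₗ Algebra.linearMap k (H β) ∘ₗ ν.toLinearMap := by
    ext x
    have := congrArg (comulOf (k := k) h) (hΛ x)
    rw [map_mul, map_smul] at this
    simpa [Algebra.algebraMap_eq_smul_one] using this
  have h3 : LinearMap.mulLeft k T ∘ₗ i₁.toLinearMap = LinearMap.mulLeft k T ∘ₗ i₂.toLinearMap ∘ₗ
      conv (one_mul α) (Algebra.linearMap k (H β) ∘ₗ ν.toLinearMap) (antipodeOf h) := by
    rw [← h1, mulLeft_comp_conv, h2, ← mulLeft_comp_conv, algHom_comp_conv]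
  exact LinearMap.congr_fun h3 c

theorem IsRightIntegral.lid_comulOf_mul_tmul_one {lam : ∀ α : π, H α →ₗ[k] k}
    (hlam : IsRightIntegral k H lam) {Λ : H (1 : π)} {ν : H (1 : π) →ₐ[k] k}
    (hΛ : ∀ x, Λ * x = ν x • Λ) {α β : π} (h : α * β = 1) (c : H α) :
    TensorProduct.lid k (H β) (TensorProduct.map (lam α) LinearMap.id
        (comulOf (k := k) h Λ * (c ⊗ₜ[k] (1 : H β))))
      = lam 1 Λ • conv (one_mul α) (Algebra.linearMap k (H β) ∘ₗ ν.toLinearMap)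
          (antipodeOf h) c := by
  have key : ∀ (t : H α ⊗[k] H β) (d : H β), TensorProduct.lid k (H β)
      (TensorProduct.map (lam α) LinearMap.id (t * ((1 : H α) ⊗ₜ[k] d)))
        = TensorProduct.lid k (H β) (TensorProduct.map (lam α) LinearMap.id t) * d := by
    intro t d
    induction t with
    | zero => simp
    | add x y hx hy => simp only [map_add, add_mul, hx, hy]
    | tmul a b => simp
  rw [comulOf_mul_tmul_one hΛ, key, ← hitLeft_eq_lid, hlam.hitLeft_eq, smul_mul_assoc, one_mul]

end HopfGCoalgebra

/-! ### Crossings -/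

namespace CrossedHopfGCoalgebra

variable {k : Type*} [Field k] {π : Type*} [Group π] {H : π → Type*}
  [∀ α, Ring (H α)] [∀ α, Algebra k (H α)] [CrossedHopfGCoalgebra k H]
  {A : Type*} [Ring A] [Algebra k A]

/-- The crossing `φ_β : H α → H γ` for `β * α * β⁻¹ = γ`. -/
def crossingOf (β : π) {α γ : π} (h : β * α * β⁻¹ = γ) : H α ≃ₐ[k] H γ :=
  (φ β α).trans (gcast k H h)

theorem comulOf_crossingOf (β : π) {α γ τ α' γ' τ' : π} (h : α * γ = τ) (h' : α' * γ' = τ')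
    (hα : β * α * β⁻¹ = α') (hγ : β * γ * β⁻¹ = γ') (hτ : β * τ * β⁻¹ = τ') (x : H τ) :
    comulOf (k := k) h' (crossingOf (k := k) β hτ x)
      = TensorProduct.map (crossingOf β hα).toLinearMap (crossingOf β hγ).toLinearMap
          (comulOf (k := k) h x) := by
  subst h hα hγ hτ
  have := LinearMap.congr_fun (φ_comul (k := k) (H := H) β α γ) x
  exact this.symm

theorem conv_comp_crossingOf (β : π) {α γ τ α' γ' τ' : π} (h : α * γ = τ) (h' : α' * γ' = τ')
    (hα : β * α * β⁻¹ = α') (hγ : β * γ * β⁻¹ = γ') (hτ : β * τ * β⁻¹ = τ')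
    (f : H α' →ₗ[k] A) (g : H γ' →ₗ[k] A) :
    conv h' f g ∘ₗ (crossingOf β hτ).toLinearMap
      = conv h (f ∘ₗ (crossingOf β hα).toLinearMap) (g ∘ₗ (crossingOf β hγ).toLinearMap) := by
  ext x
  simp only [conv_apply, LinearMap.comp_apply, AlgEquiv.toLinearMap_apply,
    comulOf_crossingOf β h h' hα hγ hτ, TensorProduct.map_comp]

theorem counit_crossingOf (β : π) (h : β * 1 * β⁻¹ = 1) (x : H (1 : π)) :
    ε (k := k) (crossingOf (k := k) β h x) = ε (k := k) (H := H) x :=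
  φ_counit β x

theorem crossingOf_crossingOf (β β' : π) {α γ τ : π} (h : β' * α * β'⁻¹ = γ)
    (h' : β * γ * β⁻¹ = τ) (hτ : (β * β') * α * (β * β')⁻¹ = τ) (x : H α) :
    crossingOf (k := k) β h' (crossingOf (k := k) β' h x) = crossingOf (k := k) (β * β') hτ x := by
  subst h hτ
  exact φ_mul β β' α x

theorem crossingOf_one {β α : π} (hβ : β = 1) (h : β * α * β⁻¹ = α) (x : H α) :
    crossingOf (k := k) β h x = x := by
  subst hβ
  apply (crossingOf (k := k) 1 h).injective
  rw [crossingOf_crossingOf 1 1 h h (by simp)]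
  have : ∀ (β : π) (_ : β = 1) (h1 : β * α * β⁻¹ = α),
      crossingOf (k := k) β h1 x = crossingOf (k := k) 1 h x := by
    rintro _ rfl h1
    rfl
  exact this _ (mul_one 1) _

theorem crossingOf_inv_cancel {β β' α γ : π} (hβ : β * β' = 1) (h : β' * α * β'⁻¹ = γ)
    (h' : β * γ * β⁻¹ = α) (x : H α) :
    crossingOf (k := k) β h' (crossingOf (k := k) β' h x) = x := by
  rw [crossingOf_crossingOf β β' h h' (by simp [hβ]), crossingOf_one hβ]

theorem distinguishedNu_crossingOf {ν : H (1 : π) →ₐ[k] k} (hν : IsDistinguishedNu k H ν)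
    {Λ : H (1 : π)} (hΛ : ∀ x, x * Λ = ε (k := k) (H := H) x • Λ) (hΛ0 : Λ ≠ 0)
    (β : π) (h : β * 1 * β⁻¹ = 1) (x : H (1 : π)) :
    ν (crossingOf (k := k) β h x) = ν x := by
  let c := crossingOf (k := k) (H := H) β h
  have hc : ∀ y, y * c Λ = ε (k := k) (H := H) y • c Λ := by
    intro y
    obtain ⟨z, rfl⟩ := c.surjective y
    rw [← map_mul, hΛ, map_smul, counit_crossingOf]
  have h1 := hν (c Λ) hc (c x)
  rw [← map_mul, hν Λ hΛ, map_smul] at h1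
  exact (smul_left_injective k ((map_ne_zero_iff c c.injective).2 hΛ0) h1).symm

end CrossedHopfGCoalgebra

/-! ### The R-matrix -/

namespace QTHopfGCoalgebra

variable {k : Type*} [Field k] {π : Type*} [Group π] {H : π → Type*}
  [∀ α, Ring (H α)] [∀ α, Algebra k (H α)] [QTHopfGCoalgebra k H]
  {A : Type*} [Ring A] [Algebra k A]

theorem Rm_mul_comulOf {α β τ δ : π} (h : α * β = τ) (hδ : δ * α = τ) (hβ : α⁻¹ * δ * α⁻¹⁻¹ = β)
    (x : H τ) :
    Rm α β * comulOf (k := k) h x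
      = TensorProduct.comm k (H β) (H α) (TensorProduct.map (crossingOf α⁻¹ hβ).toLinearMap
          LinearMap.id (comulOf (k := k) hδ x)) * Rm α β := by
  subst h
  obtain rfl : δ = α * β * α⁻¹ := by rw [← hδ, mul_inv_cancel_right]
  exact Rm_comul α β x

theorem map_conv_id_Rm {α β τ γ γ' : π} (h : α * β = τ) (hγ : β⁻¹ * γ' * β⁻¹⁻¹ = γ)
    (f : H α →ₗ[k] A) (g : H β →ₗ[k] A) :
    TensorProduct.map (conv h f g) LinearMap.id (Rm τ γ)
      = TensorProduct.map f (crossingOf β⁻¹ hγ).toLinearMap (Rm α γ')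
        * TensorProduct.map g LinearMap.id (Rm β γ) := by
  subst h
  obtain rfl : γ' = β * γ * β⁻¹ := by rw [← hγ]; group
  let Φ : H α ⊗[k] (H β ⊗[k] H γ) →ₗ[k] A ⊗[k] H γ :=
    TensorProduct.map (LinearMap.mul' k A ∘ₗ TensorProduct.map f g) LinearMap.id ∘ₗ
      (TensorProduct.assoc k (H α) (H β) (H γ)).symm.toLinearMap
  have h1 := congrArg Φ (Rm_delta_left (k := k) (H := H) α β γ)
  obtain ⟨n, a, b, hR⟩ :=
    TensorProduct.exists_sum_tmul_eq (Rm (k := k) (H := H) α (β * γ * β⁻¹))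
  obtain ⟨m, c, d, hR'⟩ := TensorProduct.exists_sum_tmul_eq (Rm (k := k) (H := H) β γ)
  rw [hR, hR'] at h1 ⊢
  have h2 : Φ (TensorProduct.assoc k (H α) (H β) (H γ) (TensorProduct.map (Δ α β).toLinearMap
      (LinearMap.id : H γ →ₗ[k] H γ) (Rm (α * β) γ)))
      = TensorProduct.map (conv rfl f g) LinearMap.id (Rm (α * β) γ) := by
    simp only [Φ, LinearMap.comp_apply, LinearEquiv.coe_coe, LinearEquiv.symm_apply_apply]
    rw [← LinearMap.comp_apply (TensorProduct.map _ _), ← TensorProduct.map_comp]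
    rfl
  rw [← h2, h1]
  simp only [map_sum, TensorProduct.map_tmul, LinearMap.id_apply, Finset.sum_mul_sum,
    TensorProduct.mk_apply, Algebra.TensorProduct.tmul_mul_tmul]
  simp [Φ, crossingOf]

theorem map_id_op_conv_Rm {α β γ τ : π} (h : β * γ = τ) (f : H β →ₗ[k] A) (g : H γ →ₗ[k] A) :
    TensorProduct.map LinearMap.id ((MulOpposite.opLinearEquiv k).toLinearMap ∘ₗ conv h f g)
        (Rm (k := k) (H := H) α τ)
      = TensorProduct.map LinearMap.id ((MulOpposite.opLinearEquiv k).toLinearMap ∘ₗ g)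
          (Rm (k := k) (H := H) α γ)
        * TensorProduct.map LinearMap.id ((MulOpposite.opLinearEquiv k).toLinearMap ∘ₗ f)
          (Rm (k := k) (H := H) α β) := by
  subst h
  let Φ : H α ⊗[k] (H β ⊗[k] H γ) →ₗ[k] H α ⊗[k] Aᵐᵒᵖ :=
    TensorProduct.map LinearMap.id ((MulOpposite.opLinearEquiv k).toLinearMap ∘ₗ
      LinearMap.mul' k A ∘ₗ TensorProduct.map f g)
  have h1 := congrArg Φ (Rm_delta_right (k := k) (H := H) α β γ)
  obtain ⟨n, a, b, hR⟩ := TensorProduct.exists_sum_tmul_eq (Rm (k := k) (H := H) α γ)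
  obtain ⟨m, c, d, hR'⟩ := TensorProduct.exists_sum_tmul_eq (Rm (k := k) (H := H) α β)
  rw [hR, hR'] at h1 ⊢
  have h2 : Φ (TensorProduct.map LinearMap.id (Δ β γ).toLinearMap (Rm α (β * γ)))
      = TensorProduct.map LinearMap.id ((MulOpposite.opLinearEquiv k).toLinearMap ∘ₗ
          conv rfl f g) (Rm (k := k) (H := H) α (β * γ)) := by
    simp only [Φ]
    rw [← LinearMap.comp_apply (TensorProduct.map _ _), ← TensorProduct.map_comp]
    rfl
  rw [← h2, h1]
  simp only [map_sum, TensorProduct.map_tmul, LinearMap.id_apply, Finset.sum_mul_sum,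
    TensorProduct.mk_apply, Algebra.TensorProduct.tmul_mul_tmul, LinearMap.flip_apply]
  simp [Φ]

theorem map_convUnit_id_Rm (γ : π) :
    TensorProduct.map (convUnit k H A) LinearMap.id (Rm (k := k) (H := H) 1 γ) = 1 := by
  have h1 := map_conv_id_Rm (k := k) (H := H) (mul_one 1) (by simp : (1 : π)⁻¹ * γ * 1⁻¹⁻¹ = γ)
    (convUnit k H A) (convUnit k H A)
  have h2 : (crossingOf (k := k) (H := H) (1 : π)⁻¹
      (by simp : (1 : π)⁻¹ * γ * 1⁻¹⁻¹ = γ)).toLinearMap = LinearMap.id := by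
    ext x
    exact crossingOf_one inv_one _ x
  rw [conv_convUnit, h2] at h1
  have hu : IsUnit (TensorProduct.map (convUnit k H A) LinearMap.id (Rm (k := k) (H := H) 1 γ)) :=
    (Rm_isUnit (k := k) (H := H) 1 γ).map (Algebra.TensorProduct.map
      ((Algebra.ofId k A).comp (ε (k := k) (H := H))) (AlgHom.id k (H γ)))
  exact hu.mul_eq_left.1 h1.symm

theorem map_id_op_convUnit_Rm (α : π) :
    TensorProduct.map LinearMap.id ((MulOpposite.opLinearEquiv k).toLinearMap ∘ₗ convUnit k H A)
      (Rm (k := k) (H := H) α 1) = 1 := by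
  have h1 := map_id_op_conv_Rm (k := k) (H := H) (α := α) (mul_one 1)
    (convUnit k H A) (convUnit k H A)
  rw [conv_convUnit] at h1
  have hu : IsUnit (TensorProduct.map LinearMap.id ((MulOpposite.opLinearEquiv k).toLinearMap ∘ₗ
      convUnit k H A) (Rm (k := k) (H := H) α 1)) :=
    (Rm_isUnit (k := k) (H := H) α 1).map (Algebra.TensorProduct.map (AlgHom.id k (H α))
      ((Algebra.ofId k Aᵐᵒᵖ).comp (ε (k := k) (H := H))))
  exact hu.mul_eq_left.1 h1.symm

end QTHopfGCoalgebra

/-! ### The Drinfeld elements -/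

namespace QTHopfGCoalgebra

variable {k : Type*} [Field k] {π : Type*} [Group π] {H : π → Type*}
  [∀ α, Ring (H α)] [∀ α, Algebra k (H α)] [QTHopfGCoalgebra k H]

/-- The antipode as an algebra homomorphism to the opposite algebra. -/
def opAntipodeOf {α β : π} (h : α * β = 1) : H α →ₐ[k] (H β)ᵐᵒᵖ :=
  AlgHom.ofLinearMap ((MulOpposite.opLinearEquiv k).toLinearMap ∘ₗ antipodeOf h)
    (by simp [antipodeOf_one]) (by simp [antipodeOf_mul])

theorem Rm_mul_map_antipodeOf_crossingOf {α β : π} (h : β * α = 1) (hc : α⁻¹ * α * α⁻¹⁻¹ = α) :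
    Rm (k := k) α α * TensorProduct.map (antipodeOf h) (crossingOf α⁻¹ hc).toLinearMap
      (Rm (k := k) (H := H) β α) = 1 := by
  have h1 := map_conv_id_Rm (k := k) (H := H) h hc (antipodeOf h) LinearMap.id
  rw [antipodeOf_conv_id, map_convUnit_id_Rm, TensorProduct.map_id, LinearMap.id_apply] at h1
  obtain ⟨u, hu⟩ := Rm_isUnit (k := k) (H := H) α α
  rw [← hu] at h1 ⊢
  rw [← Units.inv_eq_of_mul_eq_one_left h1.symm, Units.mul_inv]

/-- `R_{α,α⁻¹} = (S ⊗ S φ_{α⁻¹})(R_{α⁻¹,α})`. -/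
theorem map_id_op_Rm {α β : π} (h : α * β = 1) (h' : β * α = 1) (hc : α⁻¹ * α * α⁻¹⁻¹ = α) :
    TensorProduct.map LinearMap.id (MulOpposite.opLinearEquiv k).toLinearMap
        (Rm (k := k) (H := H) α β)
      = TensorProduct.map (antipodeOf h') ((MulOpposite.opLinearEquiv k).toLinearMap ∘ₗ
          antipodeOf h ∘ₗ (crossingOf α⁻¹ hc).toLinearMap) (Rm (k := k) (H := H) β α) := by
  have h1 := map_id_op_conv_Rm (k := k) (H := H) (α := α) h (antipodeOf h) LinearMap.id
  rw [antipodeOf_conv_id, map_id_op_convUnit_Rm, LinearMap.comp_id] at h1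
  have h2 := congrArg (Algebra.TensorProduct.map (AlgHom.id k (H α)) (opAntipodeOf (k := k) h))
    (Rm_mul_map_antipodeOf_crossingOf h' hc)
  rw [map_mul, map_one] at h2
  have h3 := left_inv_eq_right_inv h1.symm h2
  rw [h3]
  change (TensorProduct.map LinearMap.id (opAntipodeOf (k := k) h).toLinearMap ∘ₗ
    TensorProduct.map _ _) _ = _
  rw [← TensorProduct.map_comp]
  rfl

theorem drinfeld_eq {α β : π} (h : α * β = 1) (h' : β * α = 1) (hc : α * β * α⁻¹ = β) :
    drinfeld k H α = LinearMap.mul' k (H α) (TensorProduct.map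
      (antipodeOf h' ∘ₗ (crossingOf α hc).toLinearMap) LinearMap.id
        (TensorProduct.comm k (H α) (H β) (Rm α β))) := by
  obtain rfl := eq_inv_of_mul_eq_one_right h
  rfl

theorem sdrinfeld_eq {α β : π} (h : α * β = 1) (h' : β * α = 1) :
    sdrinfeld k H α
      = LinearMap.mul' k (H α) (TensorProduct.map LinearMap.id (antipodeOf h') (Rm α β)) := by
  obtain rfl := eq_inv_of_mul_eq_one_right h
  have hc : α⁻¹ * α * α⁻¹⁻¹ = α := by simp
  let Φ : H α ⊗[k] (H α⁻¹)ᵐᵒᵖ →ₗ[k] H α := LinearMap.mul' k (H α) ∘ₗ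
    TensorProduct.map LinearMap.id (antipodeOf h' ∘ₗ (MulOpposite.opLinearEquiv k).symm.toLinearMap)
  have h1 := congrArg Φ (map_id_op_Rm (k := k) (H := H) h h' hc)
  have h2 : sdrinfeld k H α = antipodeOf (k := k) h' (drinfeld k H α⁻¹) := rfl
  rw [h2, drinfeld_eq h' h hc]
  obtain ⟨n, a, b, hR⟩ := TensorProduct.exists_sum_tmul_eq (Rm (k := k) (H := H) α α⁻¹)
  obtain ⟨m, c, d, hR'⟩ := TensorProduct.exists_sum_tmul_eq (Rm (k := k) (H := H) α⁻¹ α)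
  rw [hR, hR'] at h1
  rw [hR, hR']
  simp only [Φ, map_sum, TensorProduct.map_tmul, LinearMap.comp_apply, LinearMap.mul'_apply,
    LinearMap.id_apply, LinearEquiv.coe_coe, LinearEquiv.symm_apply_apply,
    TensorProduct.comm_tmul, antipodeOf_mul] at h1 ⊢
  exact h1.symm

/-- `y S(u) = S(u) S² φ_{α⁻¹}(y)`. -/
theorem mul_sdrinfeld {α β : π} (h : α * β = 1) (h' : β * α = 1) (hα : α⁻¹ * α * α⁻¹⁻¹ = α)
    (y : H α) :
    y * sdrinfeld k H α = sdrinfeld k H α *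
      antipodeOf (k := k) h' (antipodeOf (k := k) h (crossingOf (k := k) α⁻¹ hα y)) := by
  have hβ : α⁻¹ * β * α⁻¹⁻¹ = β := by
    rw [eq_inv_of_mul_eq_one_right h]
    simp
  have h1 : α⁻¹ * 1 * α⁻¹⁻¹ = 1 := by simp
  let w := sdrinfeld k H α
  let op : H α →ₗ[k] (H α)ᵐᵒᵖ := (MulOpposite.opLinearEquiv k).toLinearMap
  let P : H α →ₗ[k] (H α)ᵐᵒᵖ := op ∘ₗ antipodeOf h' ∘ₗ antipodeOf h ∘ₗ
    (crossingOf α⁻¹ hα).toLinearMap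
  let Q : H β →ₗ[k] (H α)ᵐᵒᵖ := op ∘ₗ antipodeOf h' ∘ₗ (crossingOf α⁻¹ hβ).toLinearMap
  let J : H α →ₗ[k] (H α)ᵐᵒᵖ := op ∘ₗ LinearMap.mulRight k w
  have hPQ : conv h P Q = convUnit k H (H α)ᵐᵒᵖ := by
    have := conv_comp_crossingOf (k := k) (H := H) α⁻¹ h h hα hβ h1
      ((opAntipodeOf h').toLinearMap ∘ₗ antipodeOf h) (opAntipodeOf h').toLinearMap
    rw [algHom_antipodeOf_conv] at this
    refine Eq.trans this.symm ?_
    ext x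
    simp [convUnit_apply, counit_crossingOf]
  have hQJ : conv h' Q J
      = LinearMap.mulRight k (MulOpposite.op w) ∘ₗ convUnit k H (H α)ᵐᵒᵖ := by
    ext x
    have hx := congrArg (LinearMap.mul' k (H α) ∘ₗ TensorProduct.map LinearMap.id (antipodeOf h'))
      (Rm_mul_comulOf (k := k) h h' hβ x)
    obtain ⟨n, a, b, hR⟩ := TensorProduct.exists_sum_tmul_eq (Rm (k := k) (H := H) α β)
    obtain ⟨m, c, d, hs⟩ := TensorProduct.exists_sum_tmul_eq (comulOf (k := k) h x)
    obtain ⟨m', c', d', hs'⟩ := TensorProduct.exists_sum_tmul_eq (comulOf (k := k) h' x)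
    have hw : w = ∑ i, a i * antipodeOf (k := k) h' (b i) := by
      simp [w, sdrinfeld_eq h h', hR]
    rw [hR, hs, hs'] at hx
    simp only [map_sum, TensorProduct.map_tmul, TensorProduct.comm_tmul, Finset.sum_mul_sum,
      Algebra.TensorProduct.tmul_mul_tmul, LinearMap.comp_apply, LinearMap.mul'_apply,
      LinearMap.id_apply, antipodeOf_mul, AlgEquiv.toLinearMap_apply] at hx
    have hl : ∑ i, ∑ j, a i * c j * (antipodeOf (k := k) h' (d j) * antipodeOf (k := k) h' (b i))
        = ε (k := k) (H := H) x • w := by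
      have : ∀ i, ∑ j, a i * c j * (antipodeOf (k := k) h' (d j) * antipodeOf (k := k) h' (b i))
          = a i * (∑ j, c j * antipodeOf (k := k) h' (d j)) * antipodeOf (k := k) h' (b i) := by
        intro i
        simp only [Finset.mul_sum, Finset.sum_mul, mul_assoc]
      simp only [this, sum_mul_antipodeOf h h' hs, hw, Algebra.algebraMap_eq_smul_one,
        mul_smul_comm, smul_mul_assoc, mul_one, Finset.smul_sum]
    have hr : ∑ j, ∑ i, d' j * a i * (antipodeOf (k := k) h' (b i) *
          antipodeOf (k := k) h' (crossingOf (k := k) α⁻¹ hβ (c' j)))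
        = ∑ j, d' j * w * antipodeOf (k := k) h' (crossingOf (k := k) α⁻¹ hβ (c' j)) := by
      simp only [hw, Finset.mul_sum, Finset.sum_mul, mul_assoc]
    rw [hl, hr] at hx
    rw [conv_apply_of_eq_sum _ _ _ hs']
    have hx' := congrArg MulOpposite.op hx
    simpa [Q, J, op, convUnit_apply, Algebra.algebraMap_eq_smul_one] using hx'.symm
  have hJ : J = LinearMap.mulRight k (MulOpposite.op w) ∘ₗ P := by
    rw [← convUnit_conv (one_mul α) J, ← hPQ, conv_assoc h (one_mul α) h' (mul_one α), hQJ,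
      ← mulRight_comp_conv, conv_convUnit]
  exact MulOpposite.op_injective (LinearMap.congr_fun hJ y)

theorem isUnit_sdrinfeld [∀ α, FiniteDimensional k (H α)] (α : π) :
    IsUnit (sdrinfeld k H α) := by
  have h : α * α⁻¹ = 1 := mul_inv_cancel α
  have h' : α⁻¹ * α = 1 := inv_mul_cancel α
  have hα : α⁻¹ * α * α⁻¹⁻¹ = α := by simp
  obtain ⟨u, hu⟩ := Rm_isUnit (k := k) (H := H) α α⁻¹
  obtain ⟨n, a, b, hR⟩ := TensorProduct.exists_sum_tmul_eq (Rm (k := k) (H := H) α α⁻¹)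
  obtain ⟨m, c, d, hR'⟩ := TensorProduct.exists_sum_tmul_eq (↑u⁻¹ : H α ⊗[k] H α⁻¹)
  have h1 := congrArg (LinearMap.mul' k (H α) ∘ₗ TensorProduct.map LinearMap.id (antipodeOf h'))
    u.inv_mul
  have hw : sdrinfeld k H α = ∑ i, a i * antipodeOf (k := k) h' (b i) := by
    simp [sdrinfeld_eq h h', hR]
  rw [hu, hR, hR', Algebra.TensorProduct.one_def] at h1
  simp only [map_sum, TensorProduct.map_tmul, Finset.sum_mul_sum,
    Algebra.TensorProduct.tmul_mul_tmul, LinearMap.comp_apply, LinearMap.mul'_apply,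
    LinearMap.id_apply, antipodeOf_mul, antipodeOf_one, mul_one] at h1
  have h2 : ∀ j, ∑ i, c j * a i * (antipodeOf (k := k) h' (b i) * antipodeOf (k := k) h' (d j))
      = sdrinfeld k H α * (antipodeOf (k := k) h' (antipodeOf (k := k) h
          (crossingOf (k := k) α⁻¹ hα (c j))) * antipodeOf (k := k) h' (d j)) := by
    intro j
    rw [← mul_assoc, ← mul_sdrinfeld h h' hα, hw]
    simp only [Finset.mul_sum, Finset.sum_mul, mul_assoc]
  simp only [h2, ← Finset.mul_sum] at h1
  have : IsNoetherianRing (H α) := IsNoetherianRing.of_finite k (H α)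
  exact IsUnit.of_mul_eq_one _ h1

end QTHopfGCoalgebra

/-! ### The distinguished grouplike element -/

namespace QTHopfGCoalgebra

variable {k : Type*} [Field k] {π : Type*} [Group π] {H : π → Type*}
  [∀ α, Ring (H α)] [∀ α, Algebra k (H α)] [QTHopfGCoalgebra k H]

theorem isGrouplike_rid_map_rmatrix {ν : H (1 : π) →ₐ[k] k}
    (hν : ∀ (β : π) (h : β * 1 * β⁻¹ = 1) (x : H (1 : π)),
      ν (crossingOf (k := k) β h x) = ν x) :
    IsGrouplike k H (fun α => TensorProduct.rid k (H α)
      (TensorProduct.map LinearMap.id ν.toLinearMap (rmatrix k H α 1))) := by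
  refine ⟨fun α β => ?_, ?_⟩
  · have hβ : β⁻¹ * 1 * β⁻¹⁻¹ = 1 := by simp
    let i₁ : H α →ₐ[k] H α ⊗[k] H β := Algebra.TensorProduct.includeLeft
    let i₂ : H β →ₐ[k] H α ⊗[k] H β := Algebra.TensorProduct.includeRight
    have h1 := congrArg ((TensorProduct.rid k (H α ⊗[k] H β)).toLinearMap ∘ₗ
      TensorProduct.map LinearMap.id ν.toLinearMap)
      (map_conv_id_Rm (k := k) (H := H) (rfl : α * β = α * β) hβ i₁.toLinearMap i₂.toLinearMap)
    obtain ⟨n, a, b, hR⟩ := TensorProduct.exists_sum_tmul_eq (Rm (k := k) (H := H) α 1)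
    obtain ⟨m, c, d, hR'⟩ := TensorProduct.exists_sum_tmul_eq (Rm (k := k) (H := H) β 1)
    obtain ⟨l, e, f, hRαβ⟩ := TensorProduct.exists_sum_tmul_eq (Rm (k := k) (H := H) (α * β) 1)
    rw [includeLeft_conv_includeRight, hR, hR', hRαβ] at h1
    simp only [rmatrix, hR, hR', hRαβ]
    simp only [map_sum, TensorProduct.map_tmul, LinearMap.id_apply, Finset.sum_mul_sum,
      Algebra.TensorProduct.tmul_mul_tmul, LinearMap.comp_apply, LinearEquiv.coe_coe,
      TensorProduct.rid_tmul, AlgHom.toLinearMap_apply, AlgEquiv.toLinearMap_apply, map_mul, hν,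
      i₁, i₂, Algebra.TensorProduct.includeLeft_apply, Algebra.TensorProduct.includeRight_apply,
      mul_one, one_mul, comulOf_rfl] at h1
    simp only [map_sum, TensorProduct.map_tmul, LinearMap.id_apply, TensorProduct.rid_tmul,
      AlgHom.toLinearMap_apply, map_smul, TensorProduct.sum_tmul, TensorProduct.tmul_sum, h1,
      TensorProduct.smul_tmul_smul]
    exact Finset.sum_comm
  · have h1 := congrArg ((TensorProduct.rid k k).toLinearMap ∘ₗ
      TensorProduct.map LinearMap.id ν.toLinearMap)
      (map_convUnit_id_Rm (k := k) (H := H) (A := k) 1)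
    obtain ⟨n, a, b, hR⟩ := TensorProduct.exists_sum_tmul_eq (Rm (k := k) (H := H) (1 : π) 1)
    rw [hR, Algebra.TensorProduct.one_def] at h1
    simp only [rmatrix, hR]
    simpa [convUnit_apply] using h1

theorem rid_map_comulOf {g : ∀ α : π, H α}
    (hg : IsDistinguishedGrouplike k H g) {lam : ∀ α : π, H α →ₗ[k] k}
    (hlam : IsRightIntegral k H lam) {α β τ : π} (h : α * β = τ) (x : H τ) :
    TensorProduct.rid k (H α) (TensorProduct.map LinearMap.id (lam β) (comulOf (k := k) h x))
      = lam τ x • g α := by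
  subst h
  exact hg.2 lam hlam α β x

/-- `(id ⊗ λ)(R Δ(Λ)) = S(u) g`. -/
theorem rid_map_Rm_mul_comulOf {g : ∀ α : π, H α} (hg : IsDistinguishedGrouplike k H g)
    {lam : ∀ α : π, H α →ₗ[k] k} (hlam : IsRightIntegral k H lam) {Λ : H (1 : π)}
    (hΛ : ∀ x, x * Λ = ε (k := k) (H := H) x • Λ) {α β : π} (h : α * β = 1) (h' : β * α = 1) :
    TensorProduct.rid k (H α) (TensorProduct.map LinearMap.id (lam β)
      (Rm α β * comulOf (k := k) h Λ)) = lam 1 Λ • (sdrinfeld k H α * g α) := by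
  have key : ∀ (c : H α) (t : H α ⊗[k] H β), TensorProduct.rid k (H α)
      (TensorProduct.map LinearMap.id (lam β) ((c ⊗ₜ[k] (1 : H β)) * t))
        = c * TensorProduct.rid k (H α) (TensorProduct.map LinearMap.id (lam β) t) := by
    intro c t
    induction t with
    | zero => simp
    | add x y hx hy => simp only [map_add, mul_add, hx, hy]
    | tmul a b => simp
  obtain ⟨n, a, b, hR⟩ := TensorProduct.exists_sum_tmul_eq (Rm (k := k) (H := H) α β)
  have h1 : Rm α β * comulOf (k := k) h Λ
      = (sdrinfeld k H α ⊗ₜ[k] (1 : H β)) * comulOf (k := k) h Λ := by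
    have h2 : ∀ i, (a i ⊗ₜ[k] b i) * comulOf (k := k) h Λ
        = ((a i * antipodeOf (k := k) h' (b i)) ⊗ₜ[k] (1 : H β)) * comulOf (k := k) h Λ := by
      intro i
      rw [← mul_one (a i), ← one_mul (b i), ← Algebra.TensorProduct.tmul_mul_tmul, mul_assoc,
        one_tmul_mul_comulOf hΛ h h', ← mul_assoc, Algebra.TensorProduct.tmul_mul_tmul]
      simp
    rw [sdrinfeld_eq h h', hR, Finset.sum_mul]
    simp only [h2, map_sum, TensorProduct.map_tmul, LinearMap.mul'_apply, LinearMap.id_apply,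
      TensorProduct.sum_tmul, Finset.sum_mul]
  rw [h1, key, rid_map_comulOf hg hlam, mul_smul_comm]

/-- `ν(b₁) S φ_α(b₂) a = u h`, where `R = a ⊗ b` and `h = (id ⊗ ν)(R_{α,1})`. -/
theorem sum_conv_crossingOf_mul {ν : H (1 : π) →ₐ[k] k}
    (hν : ∀ (β : π) (h : β * 1 * β⁻¹ = 1) (x : H (1 : π)), ν (crossingOf (k := k) β h x) = ν x)
    {α β : π} (h : α * β = 1) (h' : β * α = 1) (hc : α * β * α⁻¹ = β)
    {n : ℕ} {a : Fin n → H α} {b : Fin n → H β}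
    (hR : Rm (k := k) (H := H) α β = ∑ i, a i ⊗ₜ[k] b i) :
    ∑ i, conv (one_mul β) (Algebra.linearMap k (H α) ∘ₗ ν.toLinearMap) (antipodeOf h')
        (crossingOf (k := k) α hc (b i)) * a i
      = drinfeld k H α * TensorProduct.rid k (H α)
          (TensorProduct.map LinearMap.id ν.toLinearMap (rmatrix k H α 1)) := by
  have h1 : α * 1 * α⁻¹ = 1 := by simp
  have hconv := conv_comp_crossingOf (k := k) (H := H) α (one_mul β) (one_mul β) h1 hc hc
    (Algebra.linearMap k (H α) ∘ₗ ν.toLinearMap) (antipodeOf h')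
  have hνc : (Algebra.linearMap k (H α) ∘ₗ ν.toLinearMap) ∘ₗ (crossingOf α h1).toLinearMap
      = Algebra.linearMap k (H α) ∘ₗ ν.toLinearMap := by
    ext x
    simp [hν]
  rw [hνc] at hconv
  let Φ : H α ⊗[k] (H α)ᵐᵒᵖ →ₗ[k] H α := LinearMap.mul' k (H α) ∘ₗ
    (TensorProduct.comm k (H α) (H α)).toLinearMap ∘ₗ
    TensorProduct.map LinearMap.id (MulOpposite.opLinearEquiv k).symm.toLinearMap
  have h2 := congrArg Φ (map_id_op_conv_Rm (k := k) (H := H) (α := α) (one_mul β)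
    (Algebra.linearMap k (H α) ∘ₗ ν.toLinearMap)
    (antipodeOf h' ∘ₗ (crossingOf α hc).toLinearMap))
  obtain ⟨m, c, d, hR'⟩ := TensorProduct.exists_sum_tmul_eq (Rm (k := k) (H := H) α 1)
  rw [← hconv, hR, hR'] at h2
  rw [drinfeld_eq h h' hc, rmatrix, hR, hR']
  simp only [Φ, map_sum, TensorProduct.map_tmul, Finset.sum_mul_sum,
    Algebra.TensorProduct.tmul_mul_tmul, LinearMap.comp_apply, LinearEquiv.coe_coe,
    LinearMap.id_apply, LinearMap.mul'_apply, TensorProduct.comm_tmul,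
    AlgEquiv.toLinearMap_apply, AlgHom.toLinearMap_apply,
    Algebra.linearMap_apply, TensorProduct.rid_tmul, MulOpposite.coe_opLinearEquiv,
    MulOpposite.coe_opLinearEquiv_symm, ← MulOpposite.op_mul, MulOpposite.unop_op,
    Algebra.algebraMap_eq_smul_one, smul_mul_assoc, one_mul, mul_smul_comm, ← mul_assoc] at h2 ⊢
  exact h2

/-- `(id ⊗ λ)(Λ₂ a ⊗ φ_{α⁻¹}(Λ₁) b) = c u h`, where `R = a ⊗ b`, `h = (id ⊗ ν)(R_{α,1})` and
`λ φ_{α⁻¹} = c λ`. -/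
theorem rid_map_comm_comulOf_mul_Rm {lam : ∀ α : π, H α →ₗ[k] k}
    (hlam : IsRightIntegral k H lam) {Λ : H (1 : π)} {ν : H (1 : π) →ₐ[k] k}
    (hΛ : ∀ x, Λ * x = ν x • Λ)
    (hν : ∀ (β : π) (h : β * 1 * β⁻¹ = 1) (x : H (1 : π)), ν (crossingOf (k := k) β h x) = ν x)
    {α β : π} (h : α * β = 1) (h' : β * α = 1) (hβ : α⁻¹ * β * α⁻¹⁻¹ = β) {c : k}
    (hc : ∀ x, lam β (crossingOf (k := k) α⁻¹ hβ x) = c * lam β x) :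
    TensorProduct.rid k (H α) (TensorProduct.map LinearMap.id (lam β)
      (TensorProduct.comm k (H β) (H α) (TensorProduct.map (crossingOf α⁻¹ hβ).toLinearMap
          LinearMap.id (comulOf (k := k) h' Λ)) * Rm α β))
      = (c * lam 1 Λ) • (drinfeld k H α * TensorProduct.rid k (H α)
          (TensorProduct.map LinearMap.id ν.toLinearMap (rmatrix k H α 1))) := by
  have hβ' : α * β * α⁻¹ = β := by
    rw [eq_inv_of_mul_eq_one_right h]
    simp
  obtain ⟨n, a, b, hR⟩ := TensorProduct.exists_sum_tmul_eq (Rm (k := k) (H := H) α β)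
  obtain ⟨m, s, t, hT⟩ := TensorProduct.exists_sum_tmul_eq (comulOf (k := k) h' Λ)
  have hs : ∀ i j, lam β (crossingOf (k := k) α⁻¹ hβ (s j) * b i)
      = c * lam β (s j * crossingOf (k := k) α hβ' (b i)) := by
    intro i j
    rw [← hc, map_mul (crossingOf α⁻¹ hβ), crossingOf_inv_cancel (inv_mul_cancel α)]
  have hi : ∀ i, ∑ j, lam β (s j * crossingOf (k := k) α hβ' (b i)) • t j
      = lam 1 Λ • conv (one_mul β) (Algebra.linearMap k (H α) ∘ₗ ν.toLinearMap) (antipodeOf h')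
          (crossingOf (k := k) α hβ' (b i)) := by
    intro i
    rw [← hlam.lid_comulOf_mul_tmul_one hΛ, hT]
    simp [Finset.sum_mul]
  rw [← sum_conv_crossingOf_mul hν h h' hβ' hR, mul_smul, Finset.smul_sum, hR, hT]
  simp only [← smul_mul_assoc, ← hi]
  simp only [map_sum, TensorProduct.map_tmul, LinearMap.id_apply, TensorProduct.comm_tmul,
    AlgEquiv.toLinearMap_apply]
  rw [Finset.sum_mul_sum, Finset.sum_comm]
  simp only [map_sum, TensorProduct.map_tmul, LinearMap.id_apply,
    Algebra.TensorProduct.tmul_mul_tmul, TensorProduct.rid_tmul, hs, Finset.sum_mul,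
    Finset.smul_sum, smul_mul_assoc, mul_smul]

theorem apply_crossingOf {lam : ∀ α : π, H α →ₗ[k] k} {c : k} {β : π}
    (hc : ∀ (α : π) (x : H α), lam (β * α * β⁻¹) (crossing k H β α x) = c * lam α x) {α γ : π}
    (h : β * α * β⁻¹ = γ) (x : H α) : lam γ (crossingOf (k := k) β h x) = c * lam α x := by
  subst h
  exact hc α x

end QTHopfGCoalgebra

/-- Theorem 6.6: the distinguished `π`-grouplike element of a finite dimensional
quasitriangular Hopf `π`-coalgebra is computed from the R-matrix:
`h = (id ⊗ ν)(R_{α,1})` is `π`-grouplike and `g = φ̂⁻¹ ℓ h`. -/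
theorem distinguished_grouplike_from_rmatrix (k : Type*) [Field k] {π : Type*}
    [Group π] (H : π → Type*) [∀ α, Ring (H α)] [∀ α, Algebra k (H α)]
    [QTHopfGCoalgebra k H] [∀ α, FiniteDimensional k (H α)]
    (g : ∀ α : π, H α) (hg : IsDistinguishedGrouplike k H g)
    (ν : H (1 : π) →ₐ[k] k) (hν : IsDistinguishedNu k H ν)
    (φh : π →* kˣ)
    (hφh : ∀ lam : ∀ α : π, H α →ₗ[k] k, IsRightIntegral k H lam →
      ∀ (α β : π) (x : H α),
        lam (β * α * β⁻¹) (crossing k H β α x) = (φh β : k) * lam α x) :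
    -- (a) `h = (h_α)` is a `π`-grouplike element of `H`
    IsGrouplike k H (fun α =>
      (TensorProduct.rid k (H α))
        (TensorProduct.map (LinearMap.id : H α →ₗ[k] H α) ν.toLinearMap
          (rmatrix k H α 1))) ∧
    -- (b) `g_α = φ̂(α)⁻¹ ℓ_α h_α`
    (∀ α : π,
      g α = ((φh α : k))⁻¹ •
        (ell k H α *
          (TensorProduct.rid k (H α))
            (TensorProduct.map (LinearMap.id : H α →ₗ[k] H α) ν.toLinearMap
              (rmatrix k H α 1)))) := by
  obtain ⟨lam, hlam, hne⟩ := exists_isRightIntegral_ne_zero k H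
  obtain ⟨Λ, hΛ, hlamΛ⟩ := hlam.exists_leftIntegral hne
  have hΛ0 : Λ ≠ 0 := by
    rintro rfl
    simp at hlamΛ
  have hνc := distinguishedNu_crossingOf hν hΛ hΛ0
  refine ⟨isGrouplike_rid_map_rmatrix hνc, fun α => ?_⟩
  have h : α * α⁻¹ = 1 := mul_inv_cancel α
  have h' : α⁻¹ * α = 1 := inv_mul_cancel α
  have hα : α⁻¹ * α⁻¹ * α⁻¹⁻¹ = α⁻¹ := by simp
  have key := rid_map_Rm_mul_comulOf hg hlam hΛ h h'
  rw [Rm_mul_comulOf h h' hα, rid_map_comm_comulOf_mul_Rm hlam (hν Λ hΛ) hνc h h' hα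
    (apply_crossingOf (fun α x => hφh lam hlam α _ x) hα), hlamΛ, mul_one, one_smul, map_inv,
    Units.val_inv_eq_inv_val] at key
  rw [ell, mul_assoc, ← mul_smul_comm, key, Ring.inverse_mul_cancel_left _ _ (isUnit_sdrinfeld α)]
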